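/- arXiv:1402.2888 — 2 statements merged into one kernel-verified Lean document; each statement's English description precedes it below -/
import Mathlib

section
/- If Q is a non-zero homogeneous harmonic polynomial on ℝ^n and Q₁ is a non-constant polynomial divisor of Q, then Q₁ changes sign, i.e., there exist points x, y ∈ ℝ^n with Q₁(x) > 0 and Q₁(y) < 0. -/
open MvPolynomial MeasureTheory ProbabilityTheory

/-- All moments of the standard Gaussian measure are finite. -/
theorem integrable_pow_gaussianReal (j : ℕ) :
    Integrable (fun x : ℝ => x ^ j) (gaussianReal 0 1) := by
  rcases Nat.eq_zero_or_pos j with rfl | hj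
  · simp
  · have h := (memLp_id_gaussianReal (μ := 0) (v := 1) j).integrable_norm_pow hj.ne'
    refine h.mono (by fun_prop) (Filter.Eventually.of_forall fun x => ?_)
    simp

theorem hasDerivAt_gaussianPDFReal_zero_one (x : ℝ) :
    HasDerivAt (gaussianPDFReal 0 1) (-x * gaussianPDFReal 0 1 x) x := by
  have h : HasDerivAt (fun y : ℝ => -(y - 0) ^ 2 / (2 * ((1 : NNReal) : ℝ))) (-x) x := by
    have := (((hasDerivAt_id x).sub_const 0).pow 2).neg.div_const (2 * ((1 : NNReal) : ℝ))
    convert! this using 1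
    simp [neg_div]
  convert! h.exp.const_mul ((Real.sqrt (2 * Real.pi * ((1 : NNReal) : ℝ)))⁻¹) using 1
  simp only [gaussianPDFReal]
  ring

/-- The moment recursion for the standard Gaussian measure. -/
theorem integral_pow_succ_gaussianReal (j : ℕ) :
    ∫ x, x ^ (j + 1) ∂gaussianReal 0 1 = j * ∫ x, x ^ (j - 1) ∂gaussianReal 0 1 := by
  have hintegrable (m : ℕ) : Integrable fun x : ℝ => x ^ m * gaussianPDFReal 0 1 x := by
    have h := integrable_pow_gaussianReal m
    rw [gaussianReal_of_var_ne_zero 0 one_ne_zero,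
      integrable_withDensity_iff_integrable_smul' (measurable_gaussianPDF 0 1)
        (Filter.Eventually.of_forall fun _ => gaussianPDF_lt_top)] at h
    simpa [mul_comm] using h
  have h := integral_mul_deriv_eq_deriv_mul_of_integrable
    (u := fun x : ℝ => x ^ j) (u' := fun x : ℝ => j * x ^ (j - 1))
    (v := gaussianPDFReal 0 1) (v' := fun x => -x * gaussianPDFReal 0 1 x)
    (fun x _ => hasDerivAt_pow j x) (fun x _ => hasDerivAt_gaussianPDFReal_zero_one x)
    (by
      convert (hintegrable (j + 1)).neg using 1
      ext x
      simp only [Pi.mul_apply, Pi.neg_apply]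
      ring)
    (by
      convert (hintegrable (j - 1)).const_mul (j : ℝ) using 1
      ext x
      simp only [Pi.mul_apply]
      ring)
    (hintegrable j)
  simp only [integral_gaussianReal_eq_integral_smul one_ne_zero, smul_eq_mul]
  rw [← integral_const_mul, ← neg_inj, ← integral_neg]
  calc
    _ = ∫ x : ℝ, x ^ j * (-x * gaussianPDFReal 0 1 x) := by
      congr 1 with x
      ring
    _ = _ := h
    _ = _ := by
      congr 2 with x
      ring

instance isOpenPosMeasure_gaussianReal_zero_one : (gaussianReal 0 1).IsOpenPosMeasure :=
  (gaussianReal_absolutelyContinuous' 0 one_ne_zero).isOpenPosMeasure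

namespace MvPolynomial

theorem pderiv_pderiv_comm {σ R : Type*} [CommRing R] (i j : σ) (P : MvPolynomial σ R) :
    pderiv i (pderiv j P) = pderiv j (pderiv i P) := by
  classical
  have h : ⁅pderiv (R := R) i, pderiv (R := R) j⁆ = 0 := by
    refine derivation_ext fun l => ?_
    simp only [Derivation.commutator_apply, pderiv_X, Derivation.zero_apply, Pi.single_apply]
    split_ifs <;> simp
  simpa [Derivation.commutator_apply, sub_eq_zero] using congrArg (fun D => D P) h

variable {σ : Type*} [Fintype σ]

theorem eval_monomial_eq_prod (s : σ →₀ ℕ) (c : ℝ) (x : σ → ℝ) :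
    eval x (monomial s c) = c * ∏ i, x i ^ s i := by
  rw [eval_monomial, Finsupp.prod_fintype _ _ (fun i => pow_zero _)]

theorem integrable_eval_gaussian (P : MvPolynomial σ ℝ) :
    Integrable (fun x => eval x P) (Measure.pi fun _ : σ => gaussianReal 0 1) := by
  induction P using MvPolynomial.induction_on' with
  | monomial s c =>
    simp only [eval_monomial_eq_prod]
    exact (Integrable.fintype_prod fun i => integrable_pow_gaussianReal (s i)).const_mul c
  | add P R hP hR => simpa using! hP.add hR

/-- The expectation of a polynomial under the standard Gaussian measure. -/
noncomputable def gaussianExpectation : MvPolynomial σ ℝ →ₗ[ℝ] ℝ where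
  toFun P := ∫ x, eval x P ∂Measure.pi fun _ : σ => gaussianReal 0 1
  map_add' P R := by
    simp only [map_add]
    exact integral_add (integrable_eval_gaussian P) (integrable_eval_gaussian R)
  map_smul' c P := by simp [integral_const_mul]

theorem gaussianExpectation_monomial (s : σ →₀ ℕ) (c : ℝ) :
    gaussianExpectation (monomial s c) = c * ∏ i, ∫ x, x ^ s i ∂gaussianReal 0 1 := by
  simp only [gaussianExpectation, LinearMap.coe_mk, AddHom.coe_mk, eval_monomial_eq_prod,
    integral_const_mul]
  rw [integral_fintype_prod_eq_prod (fun i (x : ℝ) => x ^ s i)]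

/-- Gaussian integration by parts for polynomials. -/
theorem gaussianExpectation_X_mul (i : σ) (P : MvPolynomial σ ℝ) :
    gaussianExpectation (X i * P) = gaussianExpectation (pderiv i P) := by
  classical
  induction P using MvPolynomial.induction_on' with
  | monomial s c =>
    rw [pderiv_monomial, X, monomial_mul, gaussianExpectation_monomial,
      gaussianExpectation_monomial, one_mul, mul_assoc,
      ← Finset.mul_prod_erase _ _ (Finset.mem_univ i),
      ← Finset.mul_prod_erase _ _ (Finset.mem_univ i), ← mul_assoc (s i : ℝ)]
    congr 2
    · simpa [add_comm] using integral_pow_succ_gaussianReal (s i)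
    · refine Finset.prod_congr rfl fun j hj => ?_
      simp [Finsupp.single_eq_of_ne (Finset.ne_of_mem_erase hj)]
  | add P R hP hR => simp [mul_add, hP, hR]

/-- A nonnegative polynomial with vanishing Gaussian expectation is zero. -/
theorem eq_zero_of_gaussianExpectation_eq_zero {P : MvPolynomial σ ℝ}
    (hP : ∀ x, 0 ≤ eval x P) (h : gaussianExpectation P = 0) : P = 0 := by
  have hae := (integral_eq_zero_iff_of_nonneg hP (integrable_eval_gaussian P)).1 h
  have heq := (Continuous.ae_eq_iff_eq _ (continuous_eval P) continuous_zero).1 hae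
  exact funext fun x => by simpa using! congrFun heq x

/-- A homogeneous harmonic polynomial is Gaussian-orthogonal to polynomials of lower degree. -/
theorem gaussianExpectation_mul_eq_zero_of_harmonic {k : ℕ} {Q P : MvPolynomial σ ℝ}
    (hQ : Q.IsHomogeneous k) (hharm : ∑ i, pderiv i (pderiv i Q) = 0)
    (hP : ∀ m, coeff m P ≠ 0 → m.degree < k) : gaussianExpectation (Q * P) = 0 := by
  induction k generalizing Q P with
  | zero =>
    have : P = 0 := by
      ext m
      by_contra hm
      exact absurd (hP m hm) (Nat.not_lt_zero _)
    simp [this]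
  | succ k ih =>
    have hcross (i : σ) : gaussianExpectation (pderiv i Q * pderiv i P) = 0 := by
      refine ih (by simpa using hQ.pderiv (i := i)) ?_ fun m hm => ?_
      · have h := congrArg (pderiv i) hharm
        rw [map_sum, map_zero] at h
        rw [← h]
        refine Finset.sum_congr rfl fun j _ => ?_
        rw [pderiv_pderiv_comm i j, pderiv_pderiv_comm i j]
      · rw [coeff_pderiv] at hm
        simpa using hP _ (left_ne_zero_of_mul hm)
    have heuler : ((k + 1 : ℕ) : ℝ) • gaussianExpectation (Q * P) = 0 := by
      rw [← map_smul, ← smul_mul_assoc, Nat.cast_smul_eq_nsmul, ← hQ.sum_X_mul_pderiv,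
        Finset.sum_mul, map_sum]
      simp only [mul_assoc, gaussianExpectation_X_mul, pderiv_mul, map_add, hcross, add_zero]
      rw [← map_sum, ← Finset.sum_mul, hharm, zero_mul, map_zero]
    exact (smul_eq_zero.1 heuler).resolve_left (by positivity)

/-- A nonconstant divisor of a nonzero homogeneous harmonic polynomial takes negative values. -/
theorem exists_eval_neg_of_mul_harmonic {k : ℕ} {Q₁ Q₂ : MvPolynomial σ ℝ}
    (hQ0 : Q₁ * Q₂ ≠ 0) (hhom : (Q₁ * Q₂).IsHomogeneous k)
    (hharm : ∑ i, pderiv i (pderiv i (Q₁ * Q₂)) = 0) (hnc : Q₁.totalDegree ≠ 0) :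
    ∃ x, eval x Q₁ < 0 := by
  by_contra! hnn
  obtain ⟨h₁, h₂⟩ := mul_ne_zero_iff.1 hQ0
  have hdeg := totalDegree_mul_of_isDomain h₁ h₂
  rw [hhom.totalDegree hQ0] at hdeg
  have hzero := gaussianExpectation_mul_eq_zero_of_harmonic (P := Q₂) hhom hharm fun m hm => by
    have := le_totalDegree (mem_support_iff.2 hm)
    rw [Finsupp.degree_apply]
    change m.sum (fun _ e => e) < k
    lia
  refine mul_ne_zero hQ0 h₂ (eq_zero_of_gaussianExpectation_eq_zero (fun x => ?_) hzero)
  rw [map_mul, map_mul, mul_assoc]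
  exact mul_nonneg (hnn x) (mul_self_nonneg _)

end MvPolynomial

/-- If `Q` is a non-zero homogeneous harmonic polynomial on `ℝⁿ` and `Q₁` is a
non-constant polynomial divisor of `Q`, then `Q₁` changes sign. -/
theorem stmt0 {n k : ℕ} (Q Q₁ Q₂ : MvPolynomial (Fin n) ℝ)
    (hQ0 : Q ≠ 0) (hhom : Q.IsHomogeneous k)
    (hharm : ∑ i : Fin n, pderiv i (pderiv i Q) = 0)
    (hdiv : Q = Q₁ * Q₂) (hnc : Q₁.totalDegree ≠ 0) :
    (∃ x : Fin n → ℝ, 0 < eval x Q₁) ∧ (∃ y : Fin n → ℝ, eval y Q₁ < 0) := by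
  subst hdiv
  refine ⟨?_, exists_eval_neg_of_mul_harmonic hQ0 hhom hharm hnc⟩
  rw [← neg_mul_neg] at hQ0 hhom hharm
  simpa using exists_eval_neg_of_mul_harmonic hQ0 hhom hharm (by rwa [totalDegree_neg])
end

section
/- Let u be real analytic and v harmonic on a neighborhood of a ∈ ℝ^n with v not identically zero, and assume Z(v) ⊆ Z(u). Then there exists a formal power series f centered at a such that u = v·f as formal power series centered at a. -/
open Filter Topology

/-- `f` is harmonic on `s`: it is `C²` there and its Laplacian vanishes. -/
def IsHarmonicOn {n : ℕ} (f : (Fin n → ℝ) → ℝ) (s : Set (Fin n → ℝ)) : Prop :=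
  ContDiffOn ℝ 2 f s ∧
    ∀ x ∈ s, ∑ i : Fin n, iteratedFDeriv ℝ 2 f x (fun _ => Pi.single i 1) = 0

/-- Partial derivative in the `i`-th coordinate direction. -/
noncomputable def pd {n : ℕ} (i : Fin n) (g : (Fin n → ℝ) → ℝ) : (Fin n → ℝ) → ℝ :=
  fun x => fderiv ℝ g x (Pi.single i 1)

/-- Multi-index partial derivative `D^α`. -/
noncomputable def mpd {n : ℕ} (α : Fin n → ℕ) (g : (Fin n → ℝ) → ℝ) :
    (Fin n → ℝ) → ℝ :=
  ((List.ofFn fun i : Fin n => (pd i)^[α i]).foldr (· ∘ ·) id) g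

/-- The formal Taylor series of `g` at `a`, as a multivariate formal power series:
the coefficient of `x^α` is `D^α g (a) / α!`. -/
noncomputable def taylorSeriesAt {n : ℕ} (g : (Fin n → ℝ) → ℝ) (a : Fin n → ℝ) :
    MvPowerSeries (Fin n) ℝ :=
  fun d => (∏ i, ((d i).factorial : ℝ))⁻¹ * mpd (fun i => d i) g a

section HarmonicDivision

open MvPolynomial MeasureTheory
open scoped ContDiff

lemma integrable_pow_mul_exp_neg_sq_half (k : ℕ) :
    Integrable (fun x : ℝ => x ^ k * Real.exp (-x ^ 2 / 2)) := by
  have h := integrable_rpow_mul_exp_neg_mul_sq (b := 1 / 2) (by norm_num) (s := k)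
    (by have : (0 : ℝ) ≤ k := k.cast_nonneg
        linarith)
  refine h.congr (ae_of_all _ fun x => ?_)
  simp only [Real.rpow_natCast]
  congr 2
  ring

lemma integral_pow_succ_mul_exp_neg_sq_half (k : ℕ) :
    ∫ x : ℝ, x ^ (k + 1) * Real.exp (-x ^ 2 / 2) =
      k * ∫ x : ℝ, x ^ (k - 1) * Real.exp (-x ^ 2 / 2) := by
  have hu : ∀ x : ℝ, HasDerivAt (fun x : ℝ => x ^ k) (k * x ^ (k - 1)) x := fun x =>
    hasDerivAt_pow k x
  have hv : ∀ x : ℝ, HasDerivAt (fun x : ℝ => -Real.exp (-x ^ 2 / 2))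
      (x * Real.exp (-x ^ 2 / 2)) x := fun x => by
    have := (((hasDerivAt_pow 2 x).neg.div_const 2).exp).neg
    refine this.congr_deriv ?_
    simp only [Pi.neg_apply]
    push_cast
    ring
  have h1 : Integrable (fun x : ℝ => x ^ k * (x * Real.exp (-x ^ 2 / 2))) :=
    (integrable_pow_mul_exp_neg_sq_half (k + 1)).congr (ae_of_all _ fun x => by ring_nf)
  have h2 : Integrable (fun x : ℝ => (k * x ^ (k - 1)) * -Real.exp (-x ^ 2 / 2)) :=
    ((integrable_pow_mul_exp_neg_sq_half (k - 1)).const_mul (-k : ℝ)).congr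
      (ae_of_all _ fun x => by ring_nf)
  have h3 : Integrable (fun x : ℝ => x ^ k * -Real.exp (-x ^ 2 / 2)) :=
    ((integrable_pow_mul_exp_neg_sq_half k).const_mul (-1 : ℝ)).congr
      (ae_of_all _ fun x => by ring_nf)
  have := integral_mul_deriv_eq_deriv_mul_of_integrable (fun x _ => hu x)
    (fun x _ => hv x) h1 h2 h3
  calc _ = ∫ x : ℝ, x ^ k * (x * Real.exp (-x ^ 2 / 2)) := by
        congr 1; ext x; ring
    _ = - ∫ x : ℝ, (k * x ^ (k - 1)) * -Real.exp (-x ^ 2 / 2) := this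
    _ = _ := by
        rw [← integral_neg, ← integral_const_mul]
        congr 1; ext x; ring

/-- The (unnormalised) Gaussian integral of a polynomial. -/
noncomputable def gaussInt {n : ℕ} (P : MvPolynomial (Fin n) ℝ) : ℝ :=
  ∫ x : Fin n → ℝ, eval x P * ∏ i, Real.exp (-(x i) ^ 2 / 2)

lemma eval_monomial_mul_gauss {n : ℕ} (d : Fin n →₀ ℕ) (c : ℝ) (x : Fin n → ℝ) :
    eval x (monomial d c) * ∏ i, Real.exp (-(x i) ^ 2 / 2) =
      c * ∏ i, ((x i) ^ d i * Real.exp (-(x i) ^ 2 / 2)) := by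
  rw [eval_monomial, Finset.prod_mul_distrib, mul_assoc,
    Finsupp.prod_fintype _ _ (fun i => pow_zero _)]

lemma integrable_eval_mul_gauss {n : ℕ} (P : MvPolynomial (Fin n) ℝ) :
    Integrable (fun x : Fin n → ℝ => eval x P * ∏ i, Real.exp (-(x i) ^ 2 / 2)) := by
  induction P using MvPolynomial.induction_on' with
  | monomial d c =>
    simp_rw [eval_monomial_mul_gauss]
    exact (Integrable.fintype_prod fun i => integrable_pow_mul_exp_neg_sq_half (d i)).const_mul c
  | add p q hp hq =>
    simp_rw [map_add, add_mul]
    exact hp.add hq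

lemma gaussInt_add {n : ℕ} (P Q : MvPolynomial (Fin n) ℝ) :
    gaussInt (P + Q) = gaussInt P + gaussInt Q := by
  unfold gaussInt
  simp_rw [map_add, add_mul]
  exact integral_add (integrable_eval_mul_gauss P) (integrable_eval_mul_gauss Q)

@[simp] lemma gaussInt_zero {n : ℕ} : gaussInt (0 : MvPolynomial (Fin n) ℝ) = 0 := by
  simp [gaussInt]

lemma gaussInt_sum {n : ℕ} {ι : Type*} (s : Finset ι) (P : ι → MvPolynomial (Fin n) ℝ) :
    gaussInt (∑ i ∈ s, P i) = ∑ i ∈ s, gaussInt (P i) :=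
  map_sum (AddMonoidHom.mk' gaussInt gaussInt_add) P s

lemma gaussInt_monomial {n : ℕ} (d : Fin n →₀ ℕ) (c : ℝ) :
    gaussInt (monomial d c) =
      c * ∏ i, ∫ x : ℝ, x ^ d i * Real.exp (-x ^ 2 / 2) := by
  unfold gaussInt
  simp_rw [eval_monomial_mul_gauss]
  rw [integral_const_mul]
  congr 1
  exact integral_fintype_prod_volume_eq_prod fun (i : Fin n) (x : ℝ) =>
    x ^ d i * Real.exp (-x ^ 2 / 2)

/-- Gaussian integration by parts. -/
lemma gaussInt_X_mul {n : ℕ} (i : Fin n) (P : MvPolynomial (Fin n) ℝ) :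
    gaussInt (X i * P) = gaussInt (pderiv i P) := by
  induction P using MvPolynomial.induction_on' with
  | monomial d c =>
    rw [pderiv_monomial, X, monomial_mul, one_mul, gaussInt_monomial, gaussInt_monomial, mul_assoc]
    congr 1
    rw [← Finset.mul_prod_erase _ _ (Finset.mem_univ i),
      ← Finset.mul_prod_erase Finset.univ (fun j => ∫ x : ℝ,
        x ^ (d - Finsupp.single i 1 : Fin n →₀ ℕ) j * Real.exp (-x ^ 2 / 2)) (Finset.mem_univ i),
      ← mul_assoc]
    congr 1
    · simp only [Finsupp.add_apply, Finsupp.single_eq_same, Finsupp.tsub_apply]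
      rw [add_comm 1, integral_pow_succ_mul_exp_neg_sq_half]
    · refine Finset.prod_congr rfl fun j hj => ?_
      have : j ≠ i := Finset.ne_of_mem_erase hj
      simp [this.symm]
  | add p q hp hq => rw [mul_add, map_add, gaussInt_add, gaussInt_add, hp, hq]

lemma gaussInt_pos {n : ℕ} {P : MvPolynomial (Fin n) ℝ} (hP : P ≠ 0)
    (h : ∀ x, 0 ≤ eval x P) : 0 < gaussInt P := by
  have hpos : ∀ x : Fin n → ℝ, 0 < ∏ i, Real.exp (-(x i) ^ 2 / 2) := fun x =>
    Finset.prod_pos fun i _ => Real.exp_pos _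
  unfold gaussInt
  rw [integral_pos_iff_support_of_nonneg (fun x => mul_nonneg (h x) (hpos x).le)
    (integrable_eval_mul_gauss P)]
  obtain ⟨x, hx⟩ : ∃ x, eval x P ≠ 0 := by
    by_contra! hc
    exact hP (MvPolynomial.funext fun x => by simpa using hc x)
  refine IsOpen.measure_pos _ (Continuous.isOpen_support ?_) ⟨x, ?_⟩
  · exact (MvPolynomial.continuous_eval P).mul (by fun_prop)
  · simpa using ⟨hx, (hpos x).ne'⟩

/-- The Laplacian of a polynomial. -/
noncomputable def polyLap {n : ℕ} (P : MvPolynomial (Fin n) ℝ) : MvPolynomial (Fin n) ℝ :=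
  ∑ i, pderiv i (pderiv i P)

lemma pderiv_comm' {n : ℕ} (i j : Fin n) (P : MvPolynomial (Fin n) ℝ) :
    pderiv i (pderiv j P) = pderiv j (pderiv i P) := by
  let D (i : Fin n) : Derivation ℝ (MvPolynomial (Fin n) ℝ) (MvPolynomial (Fin n) ℝ) := pderiv i
  have h : ⁅D i, D j⁆ = 0 := by
    ext k
    rw [Derivation.commutator_apply]
    simp only [D, pderiv_X, Pi.single_apply]
    split_ifs <;> simp
  have := congrArg (fun D : Derivation ℝ _ _ => D P) h
  rw [Derivation.commutator_apply] at this
  simpa [D, sub_eq_zero] using this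

lemma polyLap_pderiv {n : ℕ} (i : Fin n) (P : MvPolynomial (Fin n) ℝ) :
    polyLap (pderiv i P) = pderiv i (polyLap P) := by
  unfold polyLap
  rw [map_sum]
  exact Finset.sum_congr rfl fun j _ => by rw [pderiv_comm' j i, pderiv_comm' j i]

lemma totalDegree_pderiv_lt {n : ℕ} (i : Fin n) {P : MvPolynomial (Fin n) ℝ} {k : ℕ}
    (hP : P.totalDegree < k + 1) : pderiv i P = 0 ∨ (pderiv i P).totalDegree < k := by
  by_cases h : pderiv i P = 0
  · exact Or.inl h
  right
  rcases Nat.eq_zero_or_pos k with rfl | hk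
  · exfalso
    apply h
    have : P.totalDegree = 0 := by omega
    rw [totalDegree_eq_zero_iff_eq_C.1 this, pderiv_C]
  rw [totalDegree, Finset.sup_lt_iff (by simpa using hk)]
  intro m hm
  rw [mem_support_iff, coeff_pderiv] at hm
  have h2 : m + Finsupp.single i 1 ∈ P.support := by
    rw [mem_support_iff]; intro h0; simp [h0] at hm
  have := le_totalDegree h2
  rw [Finsupp.sum_add_index' (by simp) (by simp)] at this
  simp only [Finsupp.sum_single_index] at this
  omega

/-- A harmonic homogeneous polynomial of degree `k` is Gaussian-orthogonal to every polynomial of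
degree less than `k`. -/
lemma gaussInt_mul_eq_zero {n k : ℕ} {P Q : MvPolynomial (Fin n) ℝ} (hP : P.IsHomogeneous k)
    (hharm : polyLap P = 0) (hQ : Q.totalDegree < k) : gaussInt (P * Q) = 0 := by
  induction k generalizing P Q with
  | zero => omega
  | succ k ih =>
    have euler := hP.sum_X_mul_pderiv
    have h1 : ∀ i, gaussInt (pderiv i P * pderiv i Q) = 0 := fun i => by
      rcases totalDegree_pderiv_lt i hQ with h | h
      · rw [h, mul_zero, gaussInt_zero]
      · exact ih (by simpa using hP.pderiv (i := i)) (by rw [polyLap_pderiv, hharm, map_zero]) h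
    have h2 : ((k + 1 : ℕ) : ℝ) * gaussInt (P * Q) = 0 := by
      have h3 : (k + 1) • (P * Q) = ∑ i, X i * (pderiv i P * Q) := by
        rw [← smul_mul_assoc, ← euler, Finset.sum_mul]
        exact Finset.sum_congr rfl fun i _ => mul_assoc _ _ _
      have h4 := congrArg gaussInt h3
      rw [gaussInt_sum] at h4
      simp_rw [gaussInt_X_mul, Derivation.leibniz, gaussInt_add, smul_eq_mul, h1] at h4
      rw [Finset.sum_congr rfl (fun i _ => zero_add _), ← gaussInt_sum] at h4
      rw [← Finset.mul_sum] at h4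
      change _ = gaussInt (Q * polyLap P) at h4
      rw [hharm, mul_zero, gaussInt_zero] at h4
      rw [← h4, ← nsmul_eq_mul]
      exact (map_nsmul (AddMonoidHom.mk' gaussInt gaussInt_add) (k + 1) (P * Q)).symm
    have : ((k + 1 : ℕ) : ℝ) ≠ 0 := by positivity
    exact (mul_eq_zero.1 h2).resolve_left this

lemma exists_mul_add_mul_eq_C_of_isCoprime_map {A : Type*} [CommRing A] [IsDomain A]
    {p q : Polynomial A}
    (h : IsCoprime (p.map (algebraMap A (FractionRing A)))
      (q.map (algebraMap A (FractionRing A)))) :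
    ∃ (a b : Polynomial A) (r : A), r ≠ 0 ∧ a * p + b * q = Polynomial.C r := by
  obtain ⟨u, w, huw⟩ := h
  obtain ⟨c, hcM, hc⟩ := IsLocalization.integerNormalization_spec (nonZeroDivisors A) u
  obtain ⟨e, heM, he⟩ := IsLocalization.integerNormalization_spec (nonZeroDivisors A) w
  refine ⟨Polynomial.C e * IsLocalization.integerNormalization (nonZeroDivisors A) u,
    Polynomial.C c * IsLocalization.integerNormalization (nonZeroDivisors A) w, c * e,
    mul_ne_zero (nonZeroDivisors.ne_zero hcM) (nonZeroDivisors.ne_zero heM), ?_⟩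
  apply Polynomial.map_injective _ (IsFractionRing.injective A (FractionRing A))
  simp only [Polynomial.map_add, Polynomial.map_mul, Polynomial.map_C, hc, he, map_mul]
  simp only [Algebra.smul_def, Polynomial.algebraMap_apply]
  linear_combination (Polynomial.C (algebraMap A (FractionRing A) c) *
    Polynomial.C (algebraMap A (FractionRing A) e)) * huw

lemma isCoprime_map_of_prime {A : Type*} [CommRing A] [IsDomain A] [UniqueFactorizationMonoid A]
    {p q : Polynomial A} (hp : Prime p) (hdeg : p.natDegree ≠ 0) (hpq : ¬ p ∣ q) :
    IsCoprime (p.map (algebraMap A (FractionRing A)))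
      (q.map (algebraMap A (FractionRing A))) := by
  let := Classical.arbitrary (NormalizedGCDMonoid A)
  have hirr : Irreducible (p.map (algebraMap A (FractionRing A))) :=
    ((hp.irreducible.isPrimitive hdeg).irreducible_iff_irreducible_map_fraction_map).1
      hp.irreducible
  rw [hirr.coprime_iff_not_dvd]
  rintro ⟨w, hw⟩
  obtain ⟨c, hcM, hc⟩ := IsLocalization.integerNormalization_spec (nonZeroDivisors A) w
  have hdvd : p ∣ Polynomial.C c * q := by
    refine ⟨IsLocalization.integerNormalization (nonZeroDivisors A) w, ?_⟩
    apply Polynomial.map_injective _ (IsFractionRing.injective A (FractionRing A))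
    simp only [Polynomial.map_mul, Polynomial.map_C, hc, hw]
    simp only [Algebra.smul_def, Polynomial.algebraMap_apply]
    ring
  rcases hp.dvd_or_dvd hdvd with h | h
  · have h0 : Polynomial.C c ≠ 0 := by simpa using nonZeroDivisors.ne_zero hcM
    have := Polynomial.natDegree_le_of_dvd h h0
    rw [Polynomial.natDegree_C] at this
    omega
  · exact hpq h

/-- The polynomial `p (x + s d)`, as a polynomial in `s` with coefficients polynomials in `x`. -/
noncomputable def lineShift {n : ℕ} (d : Fin n → ℝ) :
    MvPolynomial (Fin n) ℝ →ₐ[ℝ] Polynomial (MvPolynomial (Fin n) ℝ) :=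
  aeval fun i => Polynomial.C (X i) + Polynomial.C (C (d i)) * Polynomial.X

lemma eval₂_lineShift {n : ℕ} (d x : Fin n → ℝ) (s : ℝ) (p : MvPolynomial (Fin n) ℝ) :
    (lineShift d p).eval₂ (eval x) s = eval (x + s • d) p := by
  have h : (Polynomial.eval₂RingHom (eval x) s).comp (lineShift d).toRingHom =
      eval (x + s • d) := by
    apply MvPolynomial.ringHom_ext
    · intro r
      simp [lineShift, Polynomial.algebraMap_apply]
    · intro i
      simp [lineShift]
      ring
  exact congrArg (fun f : _ →+* ℝ => f p) h

/-- The ring endomorphism of `ℝ[x][s]` with `x ↦ x + s d` and `s ↦ s`. -/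
noncomputable def lineShiftHom {n : ℕ} (d : Fin n → ℝ) :
    Polynomial (MvPolynomial (Fin n) ℝ) →+* Polynomial (MvPolynomial (Fin n) ℝ) :=
  Polynomial.eval₂RingHom (lineShift d).toRingHom Polynomial.X

lemma lineShiftHom_C {n : ℕ} (d : Fin n → ℝ) (p : MvPolynomial (Fin n) ℝ) :
    lineShiftHom d (Polynomial.C p) = lineShift d p := by
  simp [lineShiftHom]

lemma lineShiftHom_comp_neg {n : ℕ} (d e : Fin n → ℝ) (hde : d + e = 0) :
    (lineShiftHom d).comp (lineShiftHom e) = RingHom.id _ := by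
  apply Polynomial.ringHom_ext'
  · apply MvPolynomial.ringHom_ext
    · intro r
      simp [lineShiftHom, lineShift, Polynomial.algebraMap_apply]
    · intro i
      have h : d i + e i = 0 := congrFun hde i
      simp only [RingHom.comp_apply, lineShiftHom_C, RingHom.id_apply]
      simp only [lineShift, aeval_X, map_add, map_mul, lineShiftHom_C]
      have h2 : lineShiftHom d Polynomial.X = Polynomial.X := by simp [lineShiftHom]
      have h3 : algebraMap ℝ (Polynomial (MvPolynomial (Fin n) ℝ)) (e i) =
        Polynomial.C (C (e i)) := rfl
      have h4 : (Polynomial.C (C (d i)) + Polynomial.C (C (e i)) :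
          Polynomial (MvPolynomial (Fin n) ℝ)) = 0 := by
        rw [← map_add, ← map_add, h, map_zero, map_zero]
      rw [h2, aeval_C, h3]
      linear_combination Polynomial.X * h4
  · simp [lineShiftHom]

/-- The automorphism of `ℝ[x][s]` with `x ↦ x + s d` and `s ↦ s`. -/
noncomputable def lineShiftEquiv {n : ℕ} (d : Fin n → ℝ) :
    Polynomial (MvPolynomial (Fin n) ℝ) ≃+* Polynomial (MvPolynomial (Fin n) ℝ) :=
  RingEquiv.ofRingHom (lineShiftHom d) (lineShiftHom (-d))
    (lineShiftHom_comp_neg _ _ (by simp)) (lineShiftHom_comp_neg _ _ (by simp))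

lemma lineShiftEquiv_C {n : ℕ} (d : Fin n → ℝ) (p : MvPolynomial (Fin n) ℝ) :
    lineShiftEquiv d (Polynomial.C p) = lineShift d p :=
  lineShiftHom_C d p

lemma eq_zero_of_eventually_eval_eq_zero {n : ℕ} {R : MvPolynomial (Fin n) ℝ} {y : Fin n → ℝ}
    (h : ∀ᶠ x in 𝓝 y, eval x R = 0) : R = 0 := by
  obtain ⟨ε, hε, hb⟩ := Metric.eventually_nhds_iff.1 h
  refine MvPolynomial.funext_set (fun i => Metric.ball (y i) ε) (fun i => ?_) fun x hx => ?_
  · rw [Real.ball_eq_Ioo]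
    exact Set.Ioo_infinite (by linarith)
  · rw [map_zero]
    exact hb ((dist_pi_lt_iff hε).2 fun i => hx i (Set.mem_univ i))

/-- An irreducible real polynomial which takes both signs divides every polynomial vanishing on
its zero set. -/
lemma dvd_of_irreducible_of_sign_change {n : ℕ} {p q : MvPolynomial (Fin n) ℝ}
    (hp : Irreducible p) {y z : Fin n → ℝ} (hy : 0 < eval y p) (hz : eval z p < 0)
    (hpq : ∀ x, eval x p = 0 → eval x q = 0) : p ∣ q := by
  by_contra hndvd
  set d := z - y with hd
  have hprime : Prime (lineShift d p) := by
    rw [← lineShiftEquiv_C, MulEquiv.prime_iff (lineShiftEquiv d)]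
    exact Polynomial.prime_C_iff.2 hp.prime
  have hnd : ¬ lineShift d p ∣ lineShift d q := by
    rw [← lineShiftEquiv_C, ← lineShiftEquiv_C, map_dvd_iff]
    intro h
    exact hndvd (by simpa using (Polynomial.C_dvd_iff_dvd_coeff _ _).1 h 0)
  have hdeg : (lineShift d p).natDegree ≠ 0 := by
    intro h0
    obtain ⟨c, hc⟩ := Polynomial.natDegree_eq_zero.1 h0
    have h1 := eval₂_lineShift d y 0 p
    have h2 := eval₂_lineShift d y 1 p
    rw [← hc, Polynomial.eval₂_C] at h1 h2
    simp only [zero_smul, add_zero, one_smul, hd, add_sub_cancel] at h1 h2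
    linarith
  obtain ⟨a, b, r, hr, hab⟩ := exists_mul_add_mul_eq_C_of_isCoprime_map
    (isCoprime_map_of_prime hprime hdeg hnd)
  refine hr (eq_zero_of_eventually_eval_eq_zero (y := y) ?_)
  have hc := MvPolynomial.continuous_eval p
  have e1 : ∀ᶠ x in 𝓝 y, 0 < eval x p := hc.continuousAt.eventually (lt_mem_nhds hy)
  have e2 : ∀ᶠ x in 𝓝 y, eval (x + d) p < 0 := by
    have : ContinuousAt (fun x => eval (x + d) p) y := by fun_prop
    exact this.eventually (gt_mem_nhds (by simpa [hd] using hz))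
  filter_upwards [e1, e2] with x h1 h2
  have hcont : ContinuousOn (fun s : ℝ => eval (x + s • d) p) (Set.Icc 0 1) := by fun_prop
  obtain ⟨s, -, hs⟩ := intermediate_value_Icc' zero_le_one hcont
    (show (0 : ℝ) ∈ Set.Icc _ _ by constructor <;> simp [h1.le, h2.le])
  change eval (x + s • d) p = 0 at hs
  have := congrArg (Polynomial.eval₂ (eval x) s) hab
  rw [Polynomial.eval₂_add, Polynomial.eval₂_mul, Polynomial.eval₂_mul, eval₂_lineShift,
    eval₂_lineShift, Polynomial.eval₂_C, hs, hpq _ hs] at this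
  simpa using this.symm

lemma dvd_of_squarefree_of_irreducible_dvd {A : Type*} [CommRing A] [IsDomain A]
    [UniqueFactorizationMonoid A] {a b : A} (ha : Squarefree a)
    (h : ∀ p, Irreducible p → p ∣ a → p ∣ b) : a ∣ b := by
  induction a using WfDvdMonoid.induction_on_irreducible with
  | zero => exact absurd ha not_squarefree_zero
  | unit u hu => exact hu.dvd
  | mul a p _ hp ih =>
    obtain ⟨c, rfl⟩ := ih ha.of_mul_right fun q hq hqa => h q hq (hqa.mul_left p)
    rcases hp.prime.dvd_or_dvd (h p hp (dvd_mul_right p a)) with h1 | h1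
    · exact absurd (ha p (mul_dvd_mul_left p h1)) hp.not_isUnit
    · rw [mul_comm p a]
      exact mul_dvd_mul_left a h1

/-- Harmonic homogeneous polynomials divide every polynomial vanishing on their zero set. -/
lemma harmonic_dvd_of_zero_subset {n k : ℕ} {P Q : MvPolynomial (Fin n) ℝ} (hP0 : P ≠ 0)
    (hP : P.IsHomogeneous k) (hharm : polyLap P = 0)
    (hPQ : ∀ x, eval x P = 0 → eval x Q = 0) : P ∣ Q := by
  have hdeg : ∀ p t : MvPolynomial (Fin n) ℝ, P = p * t → ¬ IsUnit p → t.totalDegree < k := by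
    intro p t hpt hu
    have hp0 : p ≠ 0 := fun h => hP0 (by rw [hpt, h, zero_mul])
    have ht0 : t ≠ 0 := fun h => hP0 (by rw [hpt, h, mul_zero])
    have h1 : P.totalDegree = k := hP.totalDegree hP0
    rw [hpt, totalDegree_mul_of_isDomain hp0 ht0] at h1
    have : p.totalDegree ≠ 0 := fun h => by
      apply hu
      rw [totalDegree_eq_zero_iff_eq_C.1 h] at hp0 ⊢
      exact (IsUnit.mk0 _ fun h => hp0 (by rw [h, map_zero])).map C
    omega
  have hsf : Squarefree P := by
    rintro p ⟨w, hw⟩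
    by_contra hu
    rw [mul_assoc] at hw
    have h1 := gaussInt_mul_eq_zero hP hharm (Q := w)
      ((hdeg (p * p) w (by rw [hw, mul_assoc]) fun h => hu (isUnit_of_mul_isUnit_left h)))
    have h2 : P * w = (p * w) ^ 2 := by rw [hw]; ring
    have h3 : p * w ≠ 0 := fun h => hP0 (by rw [hw, h, mul_zero])
    rw [h2] at h1
    exact (gaussInt_pos (pow_ne_zero 2 h3) fun x => by rw [map_pow]; positivity).ne' h1
  have hirr : ∀ p : MvPolynomial (Fin n) ℝ, Irreducible p → p ∣ P → p ∣ Q := by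
    rintro p hp ⟨t, ht⟩
    have h1 := gaussInt_mul_eq_zero hP hharm (hdeg p t ht hp.not_isUnit)
    have ht0 : t ≠ 0 := fun h => hP0 (by rw [ht, h, mul_zero])
    have h2 : P * t = p * t ^ 2 := by rw [ht]; ring
    rw [h2] at h1
    have h3 : p * t ^ 2 ≠ 0 := mul_ne_zero hp.ne_zero (pow_ne_zero 2 ht0)
    have hpos : ∃ y, 0 < eval y p := by
      by_contra! hc
      have := gaussInt_pos (P := -(p * t ^ 2)) (neg_ne_zero.2 h3) fun x => by
        simp only [map_neg, map_mul, map_pow]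
        nlinarith [hc x, sq_nonneg (eval x t)]
      have h4 := gaussInt_add (p * t ^ 2) (-(p * t ^ 2))
      rw [add_neg_cancel, gaussInt_zero] at h4
      linarith
    have hneg : ∃ z, eval z p < 0 := by
      by_contra! hc
      have := gaussInt_pos h3 fun x => by
        simp only [map_mul, map_pow]
        exact mul_nonneg (hc x) (sq_nonneg _)
      linarith
    obtain ⟨y, hy⟩ := hpos
    obtain ⟨z, hz⟩ := hneg
    exact dvd_of_irreducible_of_sign_change hp hy hz fun x hx => hPQ x (by
      rw [ht, map_mul, hx, zero_mul])
  exact dvd_of_squarefree_of_irreducible_dvd hsf hirr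

section PartialDerivatives

variable {n : ℕ} {U : Set (Fin n → ℝ)}

lemma contDiffOn_pd (hU : IsOpen U) {g : (Fin n → ℝ) → ℝ} (hg : ContDiffOn ℝ ∞ g U)
    (i : Fin n) : ContDiffOn ℝ ∞ (pd i g) U := by
  have := hg.fderiv_of_isOpen (m := ∞) hU (by simp)
  exact this.clm_apply contDiffOn_const

lemma contDiffOn_iterate_pd (hU : IsOpen U) {g : (Fin n → ℝ) → ℝ} (hg : ContDiffOn ℝ ∞ g U)
    (i : Fin n) (k : ℕ) : ContDiffOn ℝ ∞ ((pd i)^[k] g) U := by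
  induction k generalizing g with
  | zero => exact hg
  | succ k ih => exact ih (contDiffOn_pd hU hg i)

lemma pd_congr (hU : IsOpen U) {f g : (Fin n → ℝ) → ℝ} (h : Set.EqOn f g U) (i : Fin n) :
    Set.EqOn (pd i f) (pd i g) U := fun x hx => by
  unfold pd
  rw [Filter.EventuallyEq.fderiv_eq (h.eventuallyEq_of_mem (hU.mem_nhds hx))]

lemma iterate_pd_congr (hU : IsOpen U) {f g : (Fin n → ℝ) → ℝ} (h : Set.EqOn f g U) (i : Fin n)
    (k : ℕ) : Set.EqOn ((pd i)^[k] f) ((pd i)^[k] g) U := by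
  induction k generalizing f g with
  | zero => exact h
  | succ k ih => exact ih (pd_congr hU h i)

lemma pd_pd_apply {g : (Fin n → ℝ) → ℝ} {x : Fin n → ℝ} (hg : ContDiffAt ℝ 2 g x)
    (i j : Fin n) :
    pd i (pd j g) x = fderiv ℝ (fderiv ℝ g) x (Pi.single i 1) (Pi.single j 1) := by
  have hd : DifferentiableAt ℝ (fderiv ℝ g) x :=
    (hg.fderiv_right (m := 1) (by norm_num)).differentiableAt (by simp)
  have h1 : HasFDerivAt (pd j g) ((fderiv ℝ (fderiv ℝ g) x).flip (Pi.single j 1)) x := by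
    have := hd.hasFDerivAt.clm_apply (hasFDerivAt_const (Pi.single j (1 : ℝ)) x)
    exact this.congr_fderiv (by ext; simp)
  rw [pd, h1.fderiv, ContinuousLinearMap.flip_apply]

lemma pd_comm (hU : IsOpen U) {g : (Fin n → ℝ) → ℝ} (hg : ContDiffOn ℝ ∞ g U)
    (i j : Fin n) : Set.EqOn (pd i (pd j g)) (pd j (pd i g)) U := fun x hx => by
  have h2 : ContDiffAt ℝ 2 g x := (hg.contDiffAt (hU.mem_nhds hx)).of_le (WithTop.coe_le_coe.2 (le_top : (2 : ℕ∞) ≤ ⊤))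
  rw [pd_pd_apply h2, pd_pd_apply h2]
  exact (h2.isSymmSndFDerivAt (by simp)).eq _ _

lemma pd_iterate_comm (hU : IsOpen U) {g : (Fin n → ℝ) → ℝ} (hg : ContDiffOn ℝ ∞ g U)
    (i j : Fin n) (k : ℕ) : Set.EqOn ((pd j)^[k] (pd i g)) (pd i ((pd j)^[k] g)) U := by
  induction k generalizing g with
  | zero => exact fun x _ => rfl
  | succ k ih =>
    exact (iterate_pd_congr hU (pd_comm hU hg j i) j k).trans (ih (contDiffOn_pd hU hg j))

lemma pd_sum (hU : IsOpen U) {ι : Type*} (s : Finset ι) {f : ι → (Fin n → ℝ) → ℝ}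
    (hf : ∀ i ∈ s, ContDiffOn ℝ ∞ (f i) U) (j : Fin n) :
    Set.EqOn (pd j (fun x => ∑ i ∈ s, f i x)) (fun x => ∑ i ∈ s, pd j (f i) x) U := fun x hx => by
  unfold pd
  rw [fderiv_fun_sum fun i hi => ((hf i hi).contDiffAt (hU.mem_nhds hx)).differentiableAt (by simp)]
  simp

lemma iterate_pd_sum (hU : IsOpen U) {ι : Type*} (s : Finset ι) {f : ι → (Fin n → ℝ) → ℝ}
    (hf : ∀ i ∈ s, ContDiffOn ℝ ∞ (f i) U) (j : Fin n) (k : ℕ) :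
    Set.EqOn ((pd j)^[k] (fun x => ∑ i ∈ s, f i x)) (fun x => ∑ i ∈ s, (pd j)^[k] (f i) x) U := by
  induction k generalizing f with
  | zero => exact fun x _ => rfl
  | succ k ih =>
    exact (iterate_pd_congr hU (pd_sum hU s hf j) j k).trans
      (ih fun i hi => contDiffOn_pd hU (hf i hi) j)

/-- The composition of the operators `∂ᵢ ^ (α i)` for `i` running through a list. -/
noncomputable def mpdList (α : Fin n → ℕ) (l : List (Fin n)) (g : (Fin n → ℝ) → ℝ) :
    (Fin n → ℝ) → ℝ :=
  ((l.map fun i : Fin n => (pd i)^[α i]).foldr (· ∘ ·) id) g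

lemma mpd_eq_mpdList (α : Fin n → ℕ) : mpd α = mpdList α (List.finRange n) := by
  funext g
  rw [mpd, mpdList, List.ofFn_eq_map]

lemma mpdList_cons (α : Fin n → ℕ) (j : Fin n) (l : List (Fin n)) (g : (Fin n → ℝ) → ℝ) :
    mpdList α (j :: l) g = (pd j)^[α j] (mpdList α l g) := rfl

lemma contDiffOn_mpdList (hU : IsOpen U) {g : (Fin n → ℝ) → ℝ} (hg : ContDiffOn ℝ ∞ g U)
    (α : Fin n → ℕ) (l : List (Fin n)) : ContDiffOn ℝ ∞ (mpdList α l g) U := by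
  induction l with
  | nil => exact hg
  | cons j l ih => exact contDiffOn_iterate_pd hU ih j _

lemma mpdList_congr (hU : IsOpen U) {f g : (Fin n → ℝ) → ℝ} (h : Set.EqOn f g U)
    (α : Fin n → ℕ) (l : List (Fin n)) : Set.EqOn (mpdList α l f) (mpdList α l g) U := by
  induction l with
  | nil => exact h
  | cons j l ih => exact iterate_pd_congr hU ih j _

lemma mpdList_sum (hU : IsOpen U) {ι : Type*} (s : Finset ι) {f : ι → (Fin n → ℝ) → ℝ}
    (hf : ∀ i ∈ s, ContDiffOn ℝ ∞ (f i) U) (α : Fin n → ℕ) (l : List (Fin n)) :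
    Set.EqOn (mpdList α l (fun x => ∑ i ∈ s, f i x)) (fun x => ∑ i ∈ s, mpdList α l (f i) x) U := by
  induction l with
  | nil => exact fun x _ => rfl
  | cons j l ih =>
    exact (iterate_pd_congr hU ih j _).trans
      (iterate_pd_sum hU s (fun i hi => contDiffOn_mpdList hU (hf i hi) α l) j _)

lemma mpdList_pd_comm (hU : IsOpen U) {g : (Fin n → ℝ) → ℝ} (hg : ContDiffOn ℝ ∞ g U)
    (α : Fin n → ℕ) (l : List (Fin n)) (i : Fin n) :
    Set.EqOn (mpdList α l (pd i g)) (pd i (mpdList α l g)) U := by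
  induction l with
  | nil => exact fun x _ => rfl
  | cons j l ih =>
    exact (iterate_pd_congr hU ih j _).trans
      (pd_iterate_comm hU (contDiffOn_mpdList hU hg α l) i j _)

lemma mpdList_congr_index {α β : Fin n → ℕ} {l : List (Fin n)} (h : ∀ i ∈ l, α i = β i)
    (g : (Fin n → ℝ) → ℝ) : mpdList α l g = mpdList β l g := by
  induction l with
  | nil => rfl
  | cons j l ih =>
    rw [mpdList_cons, mpdList_cons, h j (by simp), ih fun i hi => h i (by simp [hi])]

lemma mpdList_succ (hU : IsOpen U) {g : (Fin n → ℝ) → ℝ} (hg : ContDiffOn ℝ ∞ g U)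
    {α β : Fin n → ℕ} {i : Fin n} (hi : β i = α i + 1) (hne : ∀ j, j ≠ i → β j = α j)
    {l : List (Fin n)} (hl : l.Nodup) (hil : i ∈ l) :
    Set.EqOn (mpdList β l g) (mpdList α l (pd i g)) U := by
  induction l with
  | nil => simp at hil
  | cons j l ih =>
    rw [List.nodup_cons] at hl
    rw [mpdList_cons, mpdList_cons]
    by_cases hij : i = j
    · subst hij
      rw [hi, Function.iterate_succ_apply,
        mpdList_congr_index (α := β) (β := α) (fun k hk => hne k fun h => hl.1 (h ▸ hk))]
      exact iterate_pd_congr hU (mpdList_pd_comm hU hg α l i).symm i _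
    · rw [hne j (Ne.symm hij)]
      exact iterate_pd_congr hU
        (ih hl.2 ((List.mem_cons.1 hil).resolve_left hij)) j _

lemma coeff_taylorSeriesAt (g : (Fin n → ℝ) → ℝ) (a : Fin n → ℝ) (d : Fin n →₀ ℕ) :
    MvPowerSeries.coeff d (taylorSeriesAt g a) =
      (∏ i, ((d i).factorial : ℝ))⁻¹ * mpd (fun i => d i) g a := rfl

lemma coeff_zero_taylorSeriesAt (g : (Fin n → ℝ) → ℝ) (a : Fin n → ℝ) :
    MvPowerSeries.coeff 0 (taylorSeriesAt g a) = g a := by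
  have h : ∀ l : List (Fin n), mpdList (fun _ => 0) l g = g := fun l => by
    induction l with
    | nil => rfl
    | cons j l ih => rw [mpdList_cons, ih]; rfl
  rw [coeff_taylorSeriesAt, mpd_eq_mpdList]
  simp [h]

lemma coeff_taylorSeriesAt_pd (hU : IsOpen U) {g : (Fin n → ℝ) → ℝ} (hg : ContDiffOn ℝ ∞ g U)
    {a : Fin n → ℝ} (ha : a ∈ U) (i : Fin n) (d : Fin n →₀ ℕ) :
    MvPowerSeries.coeff d (taylorSeriesAt (pd i g) a) =
      MvPowerSeries.coeff (d + Finsupp.single i 1) (taylorSeriesAt g a) * (d i + 1) := by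
  rw [coeff_taylorSeriesAt, coeff_taylorSeriesAt, mpd_eq_mpdList, mpd_eq_mpdList,
    mpdList_succ hU hg (α := fun i => d i) (β := fun j => (d + Finsupp.single i 1 : Fin n →₀ ℕ) j) (i := i)
      (by simp) (fun j hj => by simp [hj.symm]) (List.nodup_finRange n)
      (List.mem_finRange i) ha]
  have h : ∏ j, (((d + Finsupp.single i 1 : Fin n →₀ ℕ) j).factorial : ℝ) =
      (d i + 1) * ∏ j, ((d j).factorial : ℝ) := by
    rw [← Finset.mul_prod_erase _ _ (Finset.mem_univ i),
      ← Finset.mul_prod_erase Finset.univ (fun j => ((d j).factorial : ℝ)) (Finset.mem_univ i),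
      ← mul_assoc]
    congr 1
    · simp [Nat.factorial_succ]
    · refine Finset.prod_congr rfl fun j hj => ?_
      have : j ≠ i := Finset.ne_of_mem_erase hj
      simp [this.symm]
  have h1 : (d i + 1 : ℝ) ≠ 0 := by positivity
  rw [h, mul_inv]
  field_simp

lemma coeff_taylorSeriesAt_sum (hU : IsOpen U) {ι : Type*} (s : Finset ι)
    {f : ι → (Fin n → ℝ) → ℝ} (hf : ∀ i ∈ s, ContDiffOn ℝ ∞ (f i) U) {a : Fin n → ℝ}
    (ha : a ∈ U) (d : Fin n →₀ ℕ) :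
    MvPowerSeries.coeff d (taylorSeriesAt (fun x => ∑ i ∈ s, f i x) a) =
      ∑ i ∈ s, MvPowerSeries.coeff d (taylorSeriesAt (f i) a) := by
  simp only [coeff_taylorSeriesAt, mpd_eq_mpdList, ← Finset.mul_sum]
  congr 1
  exact mpdList_sum hU s hf _ _ ha

lemma taylorSeriesAt_congr (hU : IsOpen U) {f g : (Fin n → ℝ) → ℝ} (h : Set.EqOn f g U)
    {a : Fin n → ℝ} (ha : a ∈ U) : taylorSeriesAt f a = taylorSeriesAt g a := by
  ext d
  rw [coeff_taylorSeriesAt, coeff_taylorSeriesAt, mpd_eq_mpdList, mpdList_congr hU h _ _ ha]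

lemma taylorSeriesAt_zero (a : Fin n → ℝ) : taylorSeriesAt (fun _ => 0) a = 0 := by
  ext d
  have h := coeff_taylorSeriesAt_sum isOpen_univ (∅ : Finset (Fin n)) (f := fun _ _ => 0)
    (by simp) (Set.mem_univ a) d
  simpa using h

end PartialDerivatives

section PolynomialFunctions

variable {n : ℕ}

lemma contDiff_eval_mvPolynomial (P : MvPolynomial (Fin n) ℝ) {m : WithTop ℕ∞} :
    ContDiff ℝ m fun x => eval x P := by
  induction P using MvPolynomial.induction_on with
  | C c => simpa using contDiff_const
  | add p q hp hq => simpa using hp.add hq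
  | mul_X p i hp => simpa using hp.mul (contDiff_apply ℝ ℝ i)

lemma pd_eval (P : MvPolynomial (Fin n) ℝ) (i : Fin n) :
    pd i (fun x => eval x P) = fun x => eval x (pderiv i P) := by
  funext x
  have hd : ∀ Q : MvPolynomial (Fin n) ℝ, DifferentiableAt ℝ (fun x => eval x Q) x := fun Q =>
    ((contDiff_eval_mvPolynomial Q (m := 1)).differentiable (by simp)) x
  unfold pd
  induction P using MvPolynomial.induction_on with
  | C c => simp
  | add p q hp hq =>
    simp only [map_add]
    rw [fderiv_fun_add (hd p) (hd q), add_apply, hp, hq]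
  | mul_X p j hp =>
    simp only [map_mul, eval_X]
    have hX : HasFDerivAt (fun y : Fin n → ℝ => y j) (ContinuousLinearMap.proj j) x :=
      (ContinuousLinearMap.proj (R := ℝ) (φ := fun _ : Fin n => ℝ) j).hasFDerivAt
    rw [fderiv_fun_mul (hd p) hX.differentiableAt, hX.fderiv]
    simp only [add_apply, smul_apply, hp,
      ContinuousLinearMap.proj_apply, Derivation.leibniz, pderiv_X, smul_eq_mul, map_add, map_mul,
      eval_X]
    congr 2
    simp only [Pi.single_apply]
    split_ifs <;> simp_all

end PolynomialFunctions

lemma norm_le_sum_abs_apply_single {n : ℕ} (L : (Fin n → ℝ) →L[ℝ] ℝ) :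
    ‖L‖ ≤ ∑ i, |L (Pi.single i 1)| := by
  refine L.opNorm_le_bound (Finset.sum_nonneg fun i _ => abs_nonneg _) fun x => ?_
  have : L x = ∑ i, x i * L (Pi.single i 1) := by
    conv_lhs => rw [← Finset.univ_sum_single x]
    rw [map_sum]
    refine Finset.sum_congr rfl fun i _ => ?_
    rw [← smul_eq_mul, ← map_smul, ← Pi.single_smul, smul_eq_mul, mul_one]
  rw [this, Finset.sum_mul]
  refine (norm_sum_le _ _).trans (Finset.sum_le_sum fun i _ => ?_)
  rw [norm_mul, mul_comm]
  exact mul_le_mul_of_nonneg_left (norm_le_pi_norm x i) (abs_nonneg _)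

/-- Taylor's theorem: a polynomial agreeing with the Taylor series of `g` in degrees `< N`
approximates `g` to order `N`. -/
lemma isBigO_sub_eval_of_coeff_eq {n : ℕ} {U : Set (Fin n → ℝ)} (hU : IsOpen U)
    {a : Fin n → ℝ} (ha : a ∈ U) (N : ℕ) {g : (Fin n → ℝ) → ℝ} (hg : ContDiffOn ℝ ∞ g U)
    {T : MvPolynomial (Fin n) ℝ}
    (hT : ∀ d : Fin n →₀ ℕ, d.degree < N →
      T.coeff d = MvPowerSeries.coeff d (taylorSeriesAt g a)) :
    (fun x => g (a + x) - eval x T) =O[𝓝 0] fun x => ‖x‖ ^ N := by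
  have hadd : Tendsto (fun x : Fin n → ℝ => a + x) (𝓝 0) (𝓝 a) := by
    have : ContinuousAt (fun x : Fin n → ℝ => a + x) 0 := by fun_prop
    simpa [ContinuousAt] using this
  induction N generalizing g T with
  | zero =>
    simp only [pow_zero]
    have h1 : ContinuousAt (fun x => g (a + x) - eval x T) 0 := by
      refine ContinuousAt.sub (ContinuousAt.comp' (g := g) ?_ (by fun_prop))
        (MvPolynomial.continuous_eval T).continuousAt
      simpa using (hg.contDiffAt (hU.mem_nhds ha)).continuousAt
    exact h1.tendsto.isBigO_one ℝ
  | succ N ih =>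
    have hpd : ∀ i, (fun x => pd i g (a + x) - eval x (pderiv i T)) =O[𝓝 0]
        fun x => ‖x‖ ^ N := fun i => by
      refine ih (contDiffOn_pd hU hg i) fun d hd => ?_
      rw [coeff_pderiv, coeff_taylorSeriesAt_pd hU hg ha, hT]
      simpa using hd
    have hsum : (fun x => ∑ i, |pd i g (a + x) - eval x (pderiv i T)|) =O[𝓝 0]
        fun x => ‖x‖ ^ N :=
      Asymptotics.IsBigO.fun_sum fun i _ => (hpd i).norm_left
    obtain ⟨C, hC0, hC⟩ := hsum.exists_nonneg
    have hUa : ∀ᶠ x in 𝓝 (0 : Fin n → ℝ), a + x ∈ U := hadd (hU.mem_nhds ha)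
    obtain ⟨ε, hε, hball⟩ := Metric.eventually_nhds_iff_ball.1 (hC.bound.and hUa)
    have hd : ∀ x ∈ Metric.ball (0 : Fin n → ℝ) ε, HasFDerivAt (fun x => g (a + x) - eval x T)
        (fderiv ℝ g (a + x) - fderiv ℝ (fun x => eval x T) x) x := fun x hx => by
      refine HasFDerivAt.sub ((hasFDerivAt_comp_add_left a).2 ?_) ?_
      · exact ((hg.contDiffAt (hU.mem_nhds (hball x hx).2)).differentiableAt
          (by simp)).hasFDerivAt
      · exact ((contDiff_eval_mvPolynomial T (m := 1)).differentiable (by simp) x).hasFDerivAt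
    have hbd : ∀ x ∈ Metric.ball (0 : Fin n → ℝ) ε,
        ‖fderiv ℝ g (a + x) - fderiv ℝ (fun x => eval x T) x‖ ≤ C * ‖x‖ ^ N := fun x hx => by
      refine (norm_le_sum_abs_apply_single _).trans ?_
      have h1 := (hball x hx).1
      rw [Real.norm_of_nonneg (Finset.sum_nonneg fun i _ => abs_nonneg _),
        Real.norm_of_nonneg (by positivity)] at h1
      refine le_trans (le_of_eq (Finset.sum_congr rfl fun i _ => ?_)) h1
      rw [sub_apply]
      congr 2
      exact congrFun (pd_eval T i) x
    have h0 : g (a + 0) - eval 0 T = 0 := by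
      have := hT 0 (by simp)
      rw [coeff_zero_taylorSeriesAt] at this
      rw [add_zero, ← this, ← constantCoeff_eq, eval_zero, sub_self]
    refine Asymptotics.IsBigO.of_bound C ?_
    filter_upwards [Metric.ball_mem_nhds (0 : Fin n → ℝ) hε] with x hx
    rw [mem_ball_zero_iff] at hx
    have hsub : Metric.closedBall (0 : Fin n → ℝ) ‖x‖ ⊆ Metric.ball 0 ε :=
      Metric.closedBall_subset_ball hx
    have := (convex_closedBall (0 : Fin n → ℝ) ‖x‖).norm_image_sub_le_of_norm_hasFDerivWithin_le
      (fun y hy => (hd y (hsub hy)).hasFDerivWithinAt) (C := C * ‖x‖ ^ N)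
      (fun y hy => (hbd y (hsub hy)).trans (by
        have : ‖y‖ ≤ ‖x‖ := by simpa using hy
        gcongr))
      (x := 0) (y := x) (by simp) (by simp)
    rw [h0, sub_zero, sub_zero] at this
    rw [norm_pow, norm_norm, pow_succ, ← mul_assoc]
    exact this

section FormalDivision

variable {n : ℕ}

lemma le_order_sub {φ ψ : MvPowerSeries (Fin n) ℝ} {N : ℕ∞} (hφ : N ≤ φ.order)
    (hψ : N ≤ ψ.order) : N ≤ (φ - ψ).order := by
  rw [sub_eq_add_neg]
  exact (le_min hφ (by rwa [MvPowerSeries.order_neg])).trans MvPowerSeries.min_order_le_add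

lemma coeff_eq_zero_of_le_order {φ : MvPowerSeries (Fin n) ℝ} {N : ℕ} (hφ : (N : ℕ∞) ≤ φ.order)
    {d : Fin n →₀ ℕ} (hd : d.degree < N) : MvPowerSeries.coeff d φ = 0 :=
  MvPowerSeries.coeff_of_lt_order (lt_of_lt_of_le (by exact_mod_cast hd) hφ)

lemma coe_mvPowerSeries_sub (p q : MvPolynomial (Fin n) ℝ) :
    ((p - q : MvPolynomial (Fin n) ℝ) : MvPowerSeries (Fin n) ℝ) =
      (p : MvPowerSeries (Fin n) ℝ) - (q : MvPowerSeries (Fin n) ℝ) :=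
  map_sub (MvPolynomial.coeToMvPowerSeries.ringHom (σ := Fin n) (R := ℝ)) p q

/-- The homogeneous part of degree `k` of a power series. -/
noncomputable def homPart (φ : MvPowerSeries (Fin n) ℝ) (k : ℕ) : MvPolynomial (Fin n) ℝ :=
  homogeneousComponent k (MvPowerSeries.truncTotal (k + 1) φ)

lemma coeff_homPart (φ : MvPowerSeries (Fin n) ℝ) (k : ℕ) (d : Fin n →₀ ℕ) :
    (homPart φ k).coeff d = if d.degree = k then MvPowerSeries.coeff d φ else 0 := by
  rw [homPart, coeff_homogeneousComponent, MvPowerSeries.coeff_truncTotal_eq_ite]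
  split_ifs <;> first | rfl | omega

lemma isHomogeneous_homPart (φ : MvPowerSeries (Fin n) ℝ) (k : ℕ) :
    (homPart φ k).IsHomogeneous k :=
  homogeneousComponent_isHomogeneous _ _

lemma le_order_homPart (φ : MvPowerSeries (Fin n) ℝ) (k : ℕ) :
    (k : ℕ∞) ≤ (homPart φ k : MvPowerSeries (Fin n) ℝ).order := by
  refine MvPowerSeries.nat_le_order fun d hd => ?_
  rw [MvPolynomial.coeff_coe, coeff_homPart, if_neg hd.ne]

lemma succ_le_order_sub_homPart {φ : MvPowerSeries (Fin n) ℝ} {k : ℕ}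
    (hφ : (k : ℕ∞) ≤ φ.order) :
    ((k + 1 : ℕ) : ℕ∞) ≤ (φ - (homPart φ k : MvPowerSeries (Fin n) ℝ)).order := by
  refine MvPowerSeries.nat_le_order fun d hd => ?_
  rw [map_sub, MvPolynomial.coeff_coe, coeff_homPart]
  split_ifs with h
  · exact sub_self _
  · rw [sub_zero]
    exact coeff_eq_zero_of_le_order hφ (by omega)

lemma homPart_ne_zero {φ : MvPowerSeries (Fin n) ℝ} {k : ℕ} (hφ : φ.order = k) :
    homPart φ k ≠ 0 := fun h => by
  have := succ_le_order_sub_homPart (φ := φ) hφ.ge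
  rw [h, MvPolynomial.coe_zero, sub_zero, hφ] at this
  have : k + 1 ≤ k := by exact_mod_cast this
  omega

lemma order_homPart {φ : MvPowerSeries (Fin n) ℝ} {k : ℕ} (hφ : φ.order = k) :
    (homPart φ k : MvPowerSeries (Fin n) ℝ).order = k := by
  refine le_antisymm (le_of_not_gt fun h => ?_) (le_order_homPart φ k)
  apply homPart_ne_zero hφ
  ext d
  rw [coeff_homPart, coeff_zero]
  split_ifs with hd
  · have := MvPowerSeries.coeff_of_lt_order (d := d) (by rwa [hd])
    rwa [MvPolynomial.coeff_coe, coeff_homPart, if_pos hd] at this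
  · rfl

/-- If the lowest homogeneous part of `ψ` divides the lowest homogeneous part of every
`φ - ψ F` with `F` a polynomial, then `ψ` divides `φ`. -/
lemma dvd_of_homPart_dvd {φ ψ : MvPowerSeries (Fin n) ℝ} {k : ℕ} (hψ : ψ.order = k)
    (h : ∀ (N : ℕ) (F : MvPolynomial (Fin n) ℝ),
      (N : ℕ∞) ≤ (φ - ψ * (F : MvPowerSeries (Fin n) ℝ)).order →
      homPart ψ k ∣ homPart (φ - ψ * (F : MvPowerSeries (Fin n) ℝ)) N) : ψ ∣ φ := by
  have hF : ∀ N : ℕ, ∃ F : MvPolynomial (Fin n) ℝ,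
      (N : ℕ∞) ≤ (φ - ψ * (F : MvPowerSeries (Fin n) ℝ)).order := fun N => by
    induction N with
    | zero => exact ⟨0, by simp⟩
    | succ N ih =>
      obtain ⟨F, hF⟩ := ih
      obtain ⟨p, hp⟩ := h N F hF
      refine ⟨F + p, ?_⟩
      have hp' : (N : ℕ∞) ≤ k + (p : MvPowerSeries (Fin n) ℝ).order := by
        rw [← order_homPart hψ, ← MvPowerSeries.order_mul, ← MvPolynomial.coe_mul, ← hp]
        exact le_order_homPart _ _
      have hsplit : φ - ψ * ((F + p : MvPolynomial (Fin n) ℝ) : MvPowerSeries (Fin n) ℝ) =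
          (φ - ψ * (F : MvPowerSeries (Fin n) ℝ) -
            (homPart (φ - ψ * (F : MvPowerSeries (Fin n) ℝ)) N : MvPowerSeries (Fin n) ℝ)) -
          (ψ - (homPart ψ k : MvPowerSeries (Fin n) ℝ)) * (p : MvPowerSeries (Fin n) ℝ) := by
        rw [hp, MvPolynomial.coe_mul, MvPolynomial.coe_add]
        ring
      rw [hsplit]
      refine le_order_sub (succ_le_order_sub_homPart hF) ?_
      rw [MvPowerSeries.order_mul]
      refine le_trans ?_ (add_le_add_left (succ_le_order_sub_homPart hψ.ge) _)
      push_cast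
      rw [add_right_comm]
      gcongr
  choose F hF using hF
  have hFF : ∀ {M N : ℕ}, M ≤ N → ∀ d : Fin n →₀ ℕ, d.degree + k < M →
      (F M).coeff d = (F N).coeff d := fun {M N} hMN d hd => by
    have h1 : (M : ℕ∞) ≤ (ψ * ((F M - F N : MvPolynomial (Fin n) ℝ) :
        MvPowerSeries (Fin n) ℝ)).order := by
      have : ψ * ((F M - F N : MvPolynomial (Fin n) ℝ) : MvPowerSeries (Fin n) ℝ) =
          (φ - ψ * (F N : MvPowerSeries (Fin n) ℝ)) -
            (φ - ψ * (F M : MvPowerSeries (Fin n) ℝ)) := by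
        rw [coe_mvPowerSeries_sub]; ring
      rw [this]
      exact le_order_sub ((Nat.cast_le.2 hMN).trans (hF N)) (hF M)
    rw [MvPowerSeries.order_mul, hψ] at h1
    have h2 := MvPowerSeries.coeff_of_lt_order (d := d)
      (f := ((F M - F N : MvPolynomial (Fin n) ℝ) : MvPowerSeries (Fin n) ℝ)) (by
        by_contra hcon
        have h3 : (M : ℕ∞) ≤ k + (d.degree : ℕ) := h1.trans (by gcongr; exact not_lt.1 hcon)
        have h4 : M ≤ k + d.degree := by exact_mod_cast h3
        omega)
    rw [MvPolynomial.coeff_coe, MvPolynomial.coeff_sub] at h2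
    exact sub_eq_zero.1 h2
  let f : MvPowerSeries (Fin n) ℝ := fun d => (F (d.degree + k + 1)).coeff d
  refine ⟨f, ?_⟩
  rw [← sub_eq_zero, ← MvPowerSeries.order_eq_top_iff, ENat.eq_top_iff_forall_ge]
  intro M
  have hfF : (M : ℕ∞) ≤ (f - (F (M + k) : MvPowerSeries (Fin n) ℝ)).order := by
    refine MvPowerSeries.nat_le_order fun d hd => ?_
    rw [map_sub, MvPolynomial.coeff_coe, sub_eq_zero]
    exact hFF (by omega) d (by omega)
  have hsplit : φ - ψ * f = (φ - ψ * (F (M + k) : MvPowerSeries (Fin n) ℝ)) -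
      ψ * (f - (F (M + k) : MvPowerSeries (Fin n) ℝ)) := by ring
  rw [hsplit]
  refine le_order_sub (le_trans (by simp) (hF (M + k))) ?_
  rw [MvPowerSeries.order_mul]
  exact hfF.trans le_add_self

end FormalDivision

section Expansion

variable {n : ℕ}

/-- `φ` is the asymptotic expansion of `G` at the origin. -/
def HasExpansion (G : (Fin n → ℝ) → ℝ) (φ : MvPowerSeries (Fin n) ℝ) : Prop :=
  ∀ (N : ℕ) (T : MvPolynomial (Fin n) ℝ),
    (N : ℕ∞) ≤ (φ - (T : MvPowerSeries (Fin n) ℝ)).order →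
      (fun x => G x - eval x T) =O[𝓝 0] fun x => ‖x‖ ^ N

lemma hasExpansion_taylorSeriesAt {U : Set (Fin n → ℝ)} (hU : IsOpen U)
    {a : Fin n → ℝ} (ha : a ∈ U) {g : (Fin n → ℝ) → ℝ} (hg : ContDiffOn ℝ ∞ g U) :
    HasExpansion (fun x => g (a + x)) (taylorSeriesAt g a) := fun N T hT =>
  isBigO_sub_eval_of_coeff_eq hU ha N hg fun d hd => by
    have := coeff_eq_zero_of_le_order hT hd
    rw [map_sub, MvPolynomial.coeff_coe, sub_eq_zero] at this
    exact this.symm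

lemma isBigO_eval_of_le_order {N : ℕ} {T : MvPolynomial (Fin n) ℝ}
    (hT : (N : ℕ∞) ≤ (T : MvPowerSeries (Fin n) ℝ).order) :
    (fun x => eval x T) =O[𝓝 0] fun x => ‖x‖ ^ N := by
  simp_rw [eval_eq']
  refine Asymptotics.IsBigO.fun_sum fun d hd => Asymptotics.IsBigO.const_mul_left ?_ _
  have hdN : N ≤ d.degree := by
    by_contra hcon
    have := coeff_eq_zero_of_le_order hT (not_le.1 hcon)
    rw [MvPolynomial.coeff_coe] at this
    exact (mem_support_iff.1 hd) this
  refine Asymptotics.IsBigO.of_bound 1 ?_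
  filter_upwards [Metric.closedBall_mem_nhds (0 : Fin n → ℝ) one_pos] with x hx
  rw [mem_closedBall_zero_iff] at hx
  rw [one_mul, norm_prod, norm_pow, norm_norm]
  calc ∏ i, ‖x i ^ d i‖ ≤ ∏ i, ‖x‖ ^ d i := by
        refine Finset.prod_le_prod (fun i _ => norm_nonneg _) fun i _ => ?_
        rw [norm_pow]
        gcongr
        exact norm_le_pi_norm x i
    _ = ‖x‖ ^ d.degree := by
        rw [Finset.prod_pow_eq_pow_sum, Finsupp.degree_eq_sum]
    _ ≤ ‖x‖ ^ N := pow_le_pow_of_le_one (norm_nonneg _) hx hdN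

lemma le_order_sub_truncTotal (φ : MvPowerSeries (Fin n) ℝ) (N : ℕ) :
    (N : ℕ∞) ≤ (φ - (MvPowerSeries.truncTotal N φ : MvPowerSeries (Fin n) ℝ)).order := by
  refine MvPowerSeries.nat_le_order fun d hd => ?_
  rw [map_sub, MvPolynomial.coeff_coe, MvPowerSeries.coeff_truncTotal _ hd, sub_self]

lemma HasExpansion.sub_mul {G H : (Fin n → ℝ) → ℝ} {φ ψ : MvPowerSeries (Fin n) ℝ}
    (hG : HasExpansion G φ) (hH : HasExpansion H ψ) (F : MvPolynomial (Fin n) ℝ) :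
    HasExpansion (fun x => G x - H x * eval x F) (φ - ψ * (F : MvPowerSeries (Fin n) ℝ)) := by
  intro N T hT
  set A := MvPowerSeries.truncTotal N φ
  set B := MvPowerSeries.truncTotal N ψ
  have hA := le_order_sub_truncTotal φ N
  have hB := le_order_sub_truncTotal ψ N
  have hR : (N : ℕ∞) ≤ ((A - B * F - T : MvPolynomial (Fin n) ℝ) :
      MvPowerSeries (Fin n) ℝ).order := by
    have : ((A - B * F - T : MvPolynomial (Fin n) ℝ) : MvPowerSeries (Fin n) ℝ) =
        (φ - ψ * (F : MvPowerSeries (Fin n) ℝ) - (T : MvPowerSeries (Fin n) ℝ)) -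
          ((φ - (A : MvPowerSeries (Fin n) ℝ)) -
            (ψ - (B : MvPowerSeries (Fin n) ℝ)) * (F : MvPowerSeries (Fin n) ℝ)) := by
      rw [coe_mvPowerSeries_sub, coe_mvPowerSeries_sub, MvPolynomial.coe_mul]
      ring
    rw [this]
    refine le_order_sub hT (le_order_sub hA ?_)
    rw [MvPowerSeries.order_mul]
    exact hB.trans le_self_add
  have hF : (fun x => eval x F) =O[𝓝 0] fun _ : Fin n → ℝ => (1 : ℝ) :=
    (MvPolynomial.continuous_eval F).continuousAt.tendsto.isBigO_one ℝ
  have h1 := (hH N B hB).mul hF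
  simp only [mul_one] at h1
  refine (((hG N A hA).sub h1).add (isBigO_eval_of_le_order hR)).congr_left fun x => ?_
  simp only [map_sub, map_mul]
  ring

lemma HasExpansion.exists_abs_sub_le {G : (Fin n → ℝ) → ℝ} {φ : MvPowerSeries (Fin n) ℝ} {N : ℕ}
    (hG : HasExpansion G φ) (hφ : (N : ℕ∞) ≤ φ.order) (r : ℝ) :
    ∃ C, 0 < C ∧ ∀ᶠ s in 𝓝[>] (0 : ℝ), ∀ w : Fin n → ℝ, ‖w‖ ≤ r →
      |G (s • w) - s ^ N * eval w (homPart φ N)| ≤ s ^ N * (C * s) := by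
  obtain ⟨C, hC0, hC⟩ := (hG (N + 1) (homPart φ N) (succ_le_order_sub_homPart hφ)).exists_pos
  obtain ⟨ε, hε, hball⟩ := Metric.eventually_nhds_iff_ball.1 hC.bound
  refine ⟨C * (|r| + 1) ^ (N + 1), by positivity, ?_⟩
  have hsmall : ∀ᶠ s in 𝓝[>] (0 : ℝ), s * (|r| + 1) < ε := by
    have : Tendsto (fun s : ℝ => s * (|r| + 1)) (𝓝 0) (𝓝 0) := by
      have : ContinuousAt (fun s : ℝ => s * (|r| + 1)) 0 := by fun_prop
      simpa [ContinuousAt] using this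
    exact (this.mono_left nhdsWithin_le_nhds).eventually_lt_const hε
  filter_upwards [hsmall, self_mem_nhdsWithin] with s hs hs0 w hw
  rw [Set.mem_Ioi] at hs0
  have hw' : ‖w‖ ≤ |r| + 1 := by linarith [le_abs_self r]
  have hsw : ‖s • w‖ ≤ s * (|r| + 1) := by
    rw [norm_smul, Real.norm_of_nonneg hs0.le]
    gcongr
  have h := hball (s • w) (mem_ball_zero_iff.2 (hsw.trans_lt hs))
  have heval : eval (s • w) (homPart φ N) = s ^ N * eval w (homPart φ N) := by
    rw [eval_eq', eval_eq', Finset.mul_sum]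
    refine Finset.sum_congr rfl fun d hd => ?_
    have hd : d.degree = N := by
      by_contra hcon
      rw [mem_support_iff, coeff_homPart, if_neg hcon] at hd
      exact hd rfl
    simp only [Pi.smul_apply, smul_eq_mul, mul_pow, Finset.prod_mul_distrib]
    rw [Finset.prod_pow_eq_pow_sum, ← Finsupp.degree_eq_sum, hd]
    ring
  rw [heval, norm_pow, norm_norm, Real.norm_eq_abs] at h
  refine h.trans ?_
  calc C * ‖s • w‖ ^ (N + 1) ≤ C * (s * (|r| + 1)) ^ (N + 1) := by gcongr
    _ = _ := by rw [mul_pow]; ring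

end Expansion

section SignChanges

variable {n : ℕ}

/-- `G` takes positive and negative values arbitrarily close to `x`. -/
def ChangesSignAt (G : (Fin n → ℝ) → ℝ) (x : Fin n → ℝ) : Prop :=
  (∃ᶠ y in 𝓝 x, 0 < G y) ∧ ∃ᶠ y in 𝓝 x, G y < 0

lemma HasExpansion.eventually_pos {G : (Fin n → ℝ) → ℝ} {φ : MvPowerSeries (Fin n) ℝ} {N : ℕ}
    (hG : HasExpansion G φ) (hφ : (N : ℕ∞) ≤ φ.order) {w : Fin n → ℝ}
    (hw : 0 < eval w (homPart φ N)) : ∀ᶠ s in 𝓝[>] (0 : ℝ), 0 < G (s • w) := by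
  obtain ⟨C, hC0, hC⟩ := hG.exists_abs_sub_le hφ ‖w‖
  filter_upwards [hC, self_mem_nhdsWithin, nhdsWithin_le_nhds
    (eventually_lt_nhds (show (0 : ℝ) < eval w (homPart φ N) / C by positivity))] with s hs hs0 hsC
  rw [Set.mem_Ioi] at hs0
  have h1 := (abs_le.1 (hs w le_rfl)).1
  rw [lt_div_iff₀ hC0] at hsC
  have h2 : 0 < s ^ N * (eval w (homPart φ N) - C * s) :=
    mul_pos (by positivity) (by linarith)
  linarith

lemma HasExpansion.eventually_neg {G : (Fin n → ℝ) → ℝ} {φ : MvPowerSeries (Fin n) ℝ} {N : ℕ}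
    (hG : HasExpansion G φ) (hφ : (N : ℕ∞) ≤ φ.order) {w : Fin n → ℝ}
    (hw : eval w (homPart φ N) < 0) : ∀ᶠ s in 𝓝[>] (0 : ℝ), G (s • w) < 0 := by
  obtain ⟨C, hC0, hC⟩ := hG.exists_abs_sub_le hφ ‖w‖
  filter_upwards [hC, self_mem_nhdsWithin, nhdsWithin_le_nhds
    (eventually_lt_nhds (show (0 : ℝ) < -eval w (homPart φ N) / C from
      div_pos (by linarith) hC0))] with s hs hs0 hsC
  rw [Set.mem_Ioi] at hs0
  have h1 := (abs_le.1 (hs w le_rfl)).2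
  rw [lt_div_iff₀ hC0] at hsC
  have h2 : 0 < s ^ N * (-eval w (homPart φ N) - C * s) :=
    mul_pos (by positivity) (by linarith)
  linarith

lemma tendsto_add_smul (x w : Fin n → ℝ) :
    Tendsto (fun s : ℝ => x + s • w) (𝓝[>] 0) (𝓝 x) := by
  have : ContinuousAt (fun s : ℝ => x + s • w) 0 := by fun_prop
  have h := this.tendsto.mono_left (nhdsWithin_le_nhds (s := Set.Ioi 0))
  simpa using h

/-- The zeros of the lowest homogeneous part of `H` at which it changes sign are limits of
rescaled zeros of `H`, so they are zeros of the lowest part of any `G` vanishing on `Z(H)`. -/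
lemma eval_homPart_eq_zero_of_changesSignAt {G H : (Fin n → ℝ) → ℝ}
    {φ ψ : MvPowerSeries (Fin n) ℝ} {k N : ℕ} (hG : HasExpansion G φ) (hH : HasExpansion H ψ)
    (hφ : (N : ℕ∞) ≤ φ.order) (hψ : (k : ℕ∞) ≤ ψ.order)
    (hcont : ∀ᶠ x in 𝓝 0, ContinuousAt H x) (hZ : ∀ᶠ x in 𝓝 0, H x = 0 → G x = 0)
    {x : Fin n → ℝ} (hx : ChangesSignAt (fun y => eval y (homPart ψ k)) x) :
    eval x (homPart φ N) = 0 := by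
  by_contra hne
  set q := homPart φ N
  have hpos : 0 < |eval x q| := abs_pos.2 hne
  have hqc : ∀ᶠ y in 𝓝 x, |eval x q| / 2 < |eval y q| :=
    ((MvPolynomial.continuous_eval q).abs.continuousAt (x := x)).eventually_const_lt (by linarith)
  obtain ⟨r, hr, hball⟩ := Metric.eventually_nhds_iff_ball.1 hqc
  obtain ⟨y, hy, hyr⟩ := (hx.1.and_eventually (Metric.ball_mem_nhds x hr)).exists
  obtain ⟨z, hz, hzr⟩ := (hx.2.and_eventually (Metric.ball_mem_nhds x hr)).exists
  obtain ⟨C, hC0, hC⟩ := hG.exists_abs_sub_le hφ (‖x‖ + r)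
  obtain ⟨ε, hε, hnear⟩ := Metric.eventually_nhds_iff_ball.1 (hcont.and hZ)
  have hsmall : ∀ᶠ s in 𝓝[>] (0 : ℝ), s * (‖x‖ + r) < ε := by
    have : Tendsto (fun s : ℝ => s * (‖x‖ + r)) (𝓝 0) (𝓝 0) := by
      have : ContinuousAt (fun s : ℝ => s * (‖x‖ + r)) 0 := by fun_prop
      simpa [ContinuousAt] using this
    exact (this.mono_left nhdsWithin_le_nhds).eventually_lt_const hε
  have hsC : ∀ᶠ s in 𝓝[>] (0 : ℝ), s < |eval x q| / 2 / C :=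
    nhdsWithin_le_nhds (eventually_lt_nhds (by positivity))
  obtain ⟨s, hsy, hsz, hs, hss, hsC, hs0⟩ := ((hH.eventually_pos hψ hy).and
    ((hH.eventually_neg hψ hz).and (hC.and (hsmall.and (hsC.and self_mem_nhdsWithin))))).exists
  have hnorm : ∀ w ∈ Metric.ball x r, ‖w‖ ≤ ‖x‖ + r := fun w hw => by
    have : ‖w - x‖ < r := by rwa [← dist_eq_norm]
    linarith [norm_sub_norm_le w x]
  have hmem : ∀ w ∈ Metric.ball x r, s • w ∈ Metric.ball (0 : Fin n → ℝ) ε := fun w hw => by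
    rw [mem_ball_zero_iff, norm_smul, Real.norm_of_nonneg hs0.le]
    refine lt_of_le_of_lt ?_ hss
    gcongr
    exact hnorm w hw
  have hc : ContinuousOn (fun w => H (s • w)) (Metric.ball x r) := fun w hw => by
    refine ContinuousAt.continuousWithinAt ?_
    exact ContinuousAt.comp' (g := H) (hnear _ (hmem w hw)).1 (by fun_prop)
  obtain ⟨w, hw, hw0⟩ := (convex_ball x r).isPreconnected.intermediate_value hzr hyr hc
    (⟨hsz.le, hsy.le⟩ : (0 : ℝ) ∈ Set.Icc _ _)
  have h1 := hs w (hnorm w hw)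
  rw [(hnear _ (hmem w hw)).2 hw0, zero_sub, abs_neg, abs_mul, abs_of_pos (by positivity)] at h1
  have h2 : |eval w q| ≤ C * s := le_of_mul_le_mul_left h1 (by positivity)
  have h3 := hball w hw
  rw [lt_div_iff₀ hC0] at hsC
  linarith

end SignChanges

section Harmonic

variable {n : ℕ} {U : Set (Fin n → ℝ)}

lemma polyLap_homPart_taylorSeriesAt (hU : IsOpen U) {v : (Fin n → ℝ) → ℝ}
    (hv : ContDiffOn ℝ ∞ v U) (hharm : ∀ x ∈ U, ∑ i, pd i (pd i v) x = 0) {a : Fin n → ℝ}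
    (ha : a ∈ U) (k : ℕ) : polyLap (homPart (taylorSeriesAt v a) k) = 0 := by
  ext d
  simp only [polyLap, coeff_sum, coeff_pderiv, coeff_homPart, map_add, Finsupp.degree_single,
    coeff_zero]
  by_cases hk : d.degree + 1 + 1 = k
  · have h := coeff_taylorSeriesAt_sum hU Finset.univ (f := fun i => pd i (pd i v))
      (fun i _ => contDiffOn_pd hU (contDiffOn_pd hU hv i) i) ha d
    rw [taylorSeriesAt_congr hU (g := fun _ => 0) (fun x hx => hharm x hx) ha,
      taylorSeriesAt_zero] at h
    simp only [map_zero] at h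
    rw [h]
    refine Finset.sum_congr rfl fun i _ => ?_
    rw [if_pos hk, coeff_taylorSeriesAt_pd hU (contDiffOn_pd hU hv i) ha,
      coeff_taylorSeriesAt_pd hU hv ha]
  · simp [hk]

lemma exists_eval_pos_of_polyLap_eq_zero {k : ℕ} (hk : 0 < k) {P : MvPolynomial (Fin n) ℝ}
    (hP0 : P ≠ 0) (hP : P.IsHomogeneous k) (hharm : polyLap P = 0) : ∃ x, 0 < eval x P := by
  by_contra! hcon
  have h1 := gaussInt_mul_eq_zero hP hharm (Q := C (-1)) (by simpa using hk)
  refine (gaussInt_pos (P := P * C (-1)) ?_ fun x => ?_).ne' h1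
  · simpa using hP0
  · simpa using hcon x

lemma changesSignAt_of_taylorSeriesAt_ne_zero (hU : IsOpen U) {v : (Fin n → ℝ) → ℝ}
    (hv : ContDiffOn ℝ ∞ v U) (hharm : ∀ x ∈ U, ∑ i, pd i (pd i v) x = 0) {a : Fin n → ℝ}
    (ha : a ∈ U) (hva : v a = 0) (hne : taylorSeriesAt v a ≠ 0) : ChangesSignAt v a := by
  obtain ⟨k, hk⟩ := ENat.ne_top_iff_exists.1 (mt MvPowerSeries.order_eq_top_iff.1 hne)
  have hP0 := homPart_ne_zero hk.symm
  have hP := isHomogeneous_homPart (taylorSeriesAt v a) k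
  have hlap := polyLap_homPart_taylorSeriesAt hU hv hharm ha k
  have hexp := hasExpansion_taylorSeriesAt hU ha hv
  have hkpos : 0 < k := by
    rcases Nat.eq_zero_or_pos k with rfl | h
    · exfalso
      apply hP0
      ext d
      rw [coeff_homPart, coeff_zero]
      split_ifs with hd
      · rw [(Finsupp.degree_eq_zero_iff d).1 hd, coeff_zero_taylorSeriesAt, hva]
      · rfl
    · exact h
  obtain ⟨y, hy⟩ := exists_eval_pos_of_polyLap_eq_zero hkpos hP0 hP hlap
  obtain ⟨z, hz⟩ := exists_eval_pos_of_polyLap_eq_zero hkpos (neg_ne_zero.2 hP0) hP.neg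
    (by simpa [polyLap] using hlap)
  rw [map_neg, neg_pos] at hz
  exact ⟨(tendsto_add_smul a y).frequently (hexp.eventually_pos hk.le hy).frequently,
    (tendsto_add_smul a z).frequently (hexp.eventually_neg hk.le hz).frequently⟩

lemma sum_pd_pd_eval (P : MvPolynomial (Fin n) ℝ) (x : Fin n → ℝ) :
    ∑ i, pd i (pd i fun x => eval x P) x = eval x (polyLap P) := by
  simp only [pd_eval, polyLap, map_sum]

/-- Divisibility of Taylor series, given strong unique continuation for harmonic polynomials. -/
lemma taylorSeriesAt_dvd (hU : IsOpen U) {u v : (Fin n → ℝ) → ℝ} {a : Fin n → ℝ} (ha : a ∈ U)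
    (hu : ContDiffOn ℝ ∞ u U) (hv : ContDiffOn ℝ ∞ v U)
    (hharm : ∀ x ∈ U, ∑ i, pd i (pd i v) x = 0) (hne : taylorSeriesAt v a ≠ 0)
    (hZ : ∀ x ∈ U, v x = 0 → u x = 0)
    (huniq : ∀ P : MvPolynomial (Fin n) ℝ, polyLap P = 0 → ∀ x,
      taylorSeriesAt (fun y => eval y P) x = 0 → P = 0) :
    taylorSeriesAt v a ∣ taylorSeriesAt u a := by
  obtain ⟨k, hk⟩ := ENat.ne_top_iff_exists.1 (mt MvPowerSeries.order_eq_top_iff.1 hne)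
  have hP0 := homPart_ne_zero hk.symm
  have hlap := polyLap_homPart_taylorSeriesAt hU hv hharm ha k
  have hUa : ∀ᶠ x in 𝓝 (0 : Fin n → ℝ), a + x ∈ U := by
    have : ContinuousAt (fun x : Fin n → ℝ => a + x) 0 := by fun_prop
    exact this (by simpa using hU.mem_nhds ha)
  refine dvd_of_homPart_dvd hk.symm fun N F hF =>
    harmonic_dvd_of_zero_subset hP0 (isHomogeneous_homPart _ _) hlap fun x hx => ?_
  have hexpv := hasExpansion_taylorSeriesAt hU ha hv
  refine eval_homPart_eq_zero_of_changesSignAt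
    ((hasExpansion_taylorSeriesAt hU ha hu).sub_mul hexpv F) hexpv hF hk.le ?_ ?_
    (changesSignAt_of_taylorSeriesAt_ne_zero isOpen_univ
      (contDiff_eval_mvPolynomial _).contDiffOn (fun y _ => by rw [sum_pd_pd_eval, hlap, map_zero])
      (Set.mem_univ x) hx fun h => hP0 (huniq _ hlap x h))
  · filter_upwards [hUa] with x hx
    exact ContinuousAt.comp' (g := v) (hv.contDiffAt (hU.mem_nhds hx)).continuousAt (by fun_prop)
  · filter_upwards [hUa] with x hx hvx
    rw [hZ _ hx hvx, hvx, zero_mul, sub_zero]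

end Harmonic

section MaximumPrinciple

variable {n : ℕ} {U : Set (Fin n → ℝ)}

lemma deriv_deriv_nonpos_of_isLocalMax {φ : ℝ → ℝ} {t : ℝ} (hmax : IsLocalMax φ t)
    (hc : ContinuousAt φ t) : deriv (deriv φ) t ≤ 0 := by
  by_contra! hpos
  have hmin := isLocalMin_of_deriv_deriv_pos hpos hmax.deriv_eq_zero hc
  have hconst : φ =ᶠ[𝓝 t] fun _ => φ t := by
    filter_upwards [hmax, hmin] with s h1 h2 using le_antisymm h1 h2
  have := hconst.deriv.deriv_eq
  simp at this
  exact hpos.ne' this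

lemma deriv_comp_add_smul_single {g : (Fin n → ℝ) → ℝ} {y : Fin n → ℝ} {i : Fin n} {t : ℝ}
    (hg : DifferentiableAt ℝ g (y + t • Pi.single i 1)) :
    deriv (fun s : ℝ => g (y + s • Pi.single i 1)) t = pd i g (y + t • Pi.single i 1) := by
  have h1 : HasDerivAt (fun s : ℝ => y + s • (Pi.single i 1 : Fin n → ℝ)) (Pi.single i 1) t := by
    simpa using ((hasDerivAt_id t).smul_const (Pi.single i 1 : Fin n → ℝ)).const_add y
  exact (hg.hasFDerivAt.comp_hasDerivAt t h1).deriv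

lemma differentiableAt_pd {g : (Fin n → ℝ) → ℝ} {x : Fin n → ℝ} (hg : ContDiffAt ℝ 2 g x)
    (i : Fin n) : DifferentiableAt ℝ (pd i g) x := by
  have hd : DifferentiableAt ℝ (fderiv ℝ g) x :=
    (hg.fderiv_right (m := 1) (by norm_num)).differentiableAt (by simp)
  exact hd.clm_apply (differentiableAt_const _)

lemma pd_pd_nonpos_of_isLocalMax {g : (Fin n → ℝ) → ℝ} {y : Fin n → ℝ}
    (hg : ContDiffAt ℝ 2 g y) (hmax : IsLocalMax g y) (i : Fin n) : pd i (pd i g) y ≤ 0 := by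
  have hc : ContinuousAt (fun t : ℝ => y + t • (Pi.single i 1 : Fin n → ℝ)) 0 := by fun_prop
  have h0 : y + (0 : ℝ) • (Pi.single i 1 : Fin n → ℝ) = y := by simp
  have ht : Tendsto (fun t : ℝ => y + t • (Pi.single i 1 : Fin n → ℝ)) (𝓝 0) (𝓝 y) := by
    simpa [ContinuousAt] using hc
  have hmax' : IsLocalMax (fun t : ℝ => g (y + t • Pi.single i 1)) 0 := by
    filter_upwards [ht hmax] with t ht'
    simpa using ht'
  have hdiff : ∀ᶠ z in 𝓝 y, DifferentiableAt ℝ g z :=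
    (hg.eventually (by simp)).mono fun z hz => hz.differentiableAt (by simp)
  have hev : deriv (fun t : ℝ => g (y + t • Pi.single i 1)) =ᶠ[𝓝 0]
      fun t => pd i g (y + t • Pi.single i 1) := by
    filter_upwards [ht hdiff] with t ht' using deriv_comp_add_smul_single ht'
  have h1 := deriv_deriv_nonpos_of_isLocalMax hmax'
    (ContinuousAt.comp' (g := g) (by rw [h0]; exact hg.continuousAt) hc)
  rw [hev.deriv_eq, deriv_comp_add_smul_single (by rw [h0]; exact differentiableAt_pd hg i), h0]
    at h1
  exact h1

lemma sum_pd_pd_add_eval (hU : IsOpen U) {f : (Fin n → ℝ) → ℝ} (hf : ContDiffOn ℝ 2 f U)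
    (Q : MvPolynomial (Fin n) ℝ) {x : Fin n → ℝ} (hx : x ∈ U) :
    ∑ i, pd i (pd i fun y => f y + eval y Q) x =
      ∑ i, pd i (pd i f) x + eval x (polyLap Q) := by
  have hQ : ∀ (Q : MvPolynomial (Fin n) ℝ) (z : Fin n → ℝ),
      DifferentiableAt ℝ (fun y => eval y Q) z := fun Q z =>
    (contDiff_eval_mvPolynomial Q (m := 1)).differentiable (by simp) z
  have hadd : ∀ (g : (Fin n → ℝ) → ℝ) (Q : MvPolynomial (Fin n) ℝ) (z : Fin n → ℝ) (i : Fin n),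
      DifferentiableAt ℝ g z →
        pd i (fun y => g y + eval y Q) z = pd i g z + eval z (pderiv i Q) :=
    fun g Q z i hg => by
      rw [pd, fderiv_fun_add hg (hQ Q z), add_apply]
      exact congrArg _ (congrFun (pd_eval Q i) z)
  rw [polyLap, map_sum, ← Finset.sum_add_distrib]
  refine Finset.sum_congr rfl fun i _ => ?_
  have hEq : Set.EqOn (pd i fun y => f y + eval y Q) (fun y => pd i f y + eval y (pderiv i Q)) U :=
    fun z hz => hadd f Q z i ((hf.contDiffAt (hU.mem_nhds hz)).differentiableAt (by simp))
  rw [pd_congr hU hEq i hx, hadd _ _ _ _ (differentiableAt_pd (hf.contDiffAt (hU.mem_nhds hx)) i)]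

/-- The polynomial `∑ i, (Xᵢ - cᵢ)²`. -/
noncomputable def sqDist (c : Fin n → ℝ) : MvPolynomial (Fin n) ℝ := ∑ i, (X i - C (c i)) ^ 2

lemma eval_sqDist (c x : Fin n → ℝ) : eval x (sqDist c) = ∑ i, (x i - c i) ^ 2 := by
  simp [sqDist]

lemma eval_sqDist_nonneg (c x : Fin n → ℝ) : 0 ≤ eval x (sqDist c) := by
  rw [eval_sqDist]
  positivity

lemma pderiv_sqDist (c : Fin n → ℝ) (j : Fin n) :
    pderiv j (sqDist c) = 2 * (X j - C (c j)) := by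
  classical
  have h : ∀ i, pderiv j ((X i - C (c i) : MvPolynomial (Fin n) ℝ) ^ 2) =
      if i = j then 2 * (X j - C (c j)) else 0 := fun i => by
    rw [sq, Derivation.leibniz, map_sub, pderiv_C, pderiv_X, sub_zero, Pi.single_apply]
    split_ifs with h1 <;> simp_all
    ring
  rw [sqDist, map_sum, Finset.sum_congr rfl fun i _ => h i]
  simp

lemma polyLap_sqDist (c : Fin n → ℝ) : polyLap (sqDist c) = C (2 * n : ℝ) := by
  simp only [polyLap, pderiv_sqDist]
  have h : ∀ j, pderiv j (2 * (X j - C (c j)) : MvPolynomial (Fin n) ℝ) = C 2 := fun j => by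
    have h2 : (2 : MvPolynomial (Fin n) ℝ) = C 2 := (map_ofNat C 2).symm
    rw [h2, pderiv_C_mul, map_sub, pderiv_C, pderiv_X_self, sub_zero, mul_one]
  simp [h, mul_comm]

/-- The closed Euclidean ball, as a subset of the sup-normed space. -/
def euclBall (c : Fin n → ℝ) (r : ℝ) : Set (Fin n → ℝ) := {x | eval x (sqDist c) ≤ r ^ 2}

lemma euclBall_subset_closedBall (c : Fin n → ℝ) {r : ℝ} (hr : 0 ≤ r) :
    euclBall c r ⊆ Metric.closedBall c r := fun x hx => by
  rw [mem_closedBall_iff_norm, pi_norm_le_iff_of_nonneg hr]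
  intro i
  rw [euclBall, Set.mem_ofPred_eq, eval_sqDist] at hx
  have h1 := Finset.single_le_sum (f := fun i => (x i - c i) ^ 2) (fun j _ => sq_nonneg _)
    (Finset.mem_univ i)
  exact abs_le_of_sq_le_sq (h1.trans hx) hr

lemma isCompact_euclBall (c : Fin n → ℝ) {r : ℝ} (hr : 0 ≤ r) : IsCompact (euclBall c r) :=
  (isCompact_closedBall c r).of_isClosed_subset
    (isClosed_le (MvPolynomial.continuous_eval _) continuous_const)
    (euclBall_subset_closedBall c hr)

/-- The maximum principle for subharmonic functions on a ball. -/
lemma le_of_sum_pd_pd_nonneg (hn : 0 < n) (hU : IsOpen U) {f : (Fin n → ℝ) → ℝ}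
    (hf : ContDiffOn ℝ 2 f U) {c : Fin n → ℝ} {r M : ℝ} (hr : 0 < r) (hsub : euclBall c r ⊆ U)
    (hlap : ∀ x ∈ euclBall c r, 0 ≤ ∑ i, pd i (pd i f) x)
    (hM : ∀ x, eval x (sqDist c) = r ^ 2 → f x ≤ M) {x : Fin n → ℝ} (hx : x ∈ euclBall c r) :
    f x ≤ M := by
  by_contra! hcon
  obtain ⟨ε, hε, hεM⟩ : ∃ ε, 0 < ε ∧ M + ε * r ^ 2 < f x := by
    refine ⟨(f x - M) / (2 * r ^ 2), by have := sub_pos.2 hcon; positivity, ?_⟩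
    field_simp
    linarith
  set Q : MvPolynomial (Fin n) ℝ := C ε * sqDist c
  have hQ : ∀ y, eval y Q = ε * eval y (sqDist c) := fun y => by simp [Q]
  have hhC : ContDiffOn ℝ 2 (fun y => f y + eval y Q) U :=
    hf.add (contDiff_eval_mvPolynomial Q).contDiffOn
  obtain ⟨y, hy, hymax⟩ := (isCompact_euclBall c hr.le).exists_isMaxOn ⟨x, hx⟩
    (hhC.continuousOn.mono hsub)
  have h1 : f x + eval x Q ≤ f y + eval y Q := hymax hx
  rw [hQ, hQ] at h1
  have h2 := mul_nonneg hε.le (eval_sqDist_nonneg c x)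
  have hylt : eval y (sqDist c) < r ^ 2 := by
    refine lt_of_le_of_ne hy fun heq => ?_
    have := hM y heq
    rw [heq] at h1
    linarith
  have hlocal : IsLocalMax (fun y => f y + eval y Q) y := by
    refine hymax.isLocalMax (Filter.mem_of_superset
      ((isOpen_lt (MvPolynomial.continuous_eval (sqDist c)) continuous_const).mem_nhds hylt)
      fun z hz => ?_)
    rw [Set.mem_ofPred_eq] at hz
    exact hz.le
  have h3 : ∑ i, pd i (pd i fun y => f y + eval y Q) y ≤ 0 :=
    Finset.sum_nonpos fun i _ => pd_pd_nonpos_of_isLocalMax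
      (hhC.contDiffAt (hU.mem_nhds (hsub hy))) hlocal i
  rw [sum_pd_pd_add_eval hU hf Q (hsub hy)] at h3
  have h4 : polyLap Q = C (ε * (2 * n)) := by
    have : polyLap Q = C ε * polyLap (sqDist c) := by
      simp only [Q, polyLap, pderiv_C_mul, Finset.mul_sum]
    rw [this, polyLap_sqDist, ← C_mul]
  rw [h4, eval_C] at h3
  have h5 := hlap y hy
  have h6 : (0 : ℝ) < n := by exact_mod_cast hn
  have : 0 < ε * (2 * n) := by positivity
  linarith

end MaximumPrinciple

section HarmonicPolynomials

variable {n : ℕ} {U : Set (Fin n → ℝ)}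

lemma polyLap_add (P Q : MvPolynomial (Fin n) ℝ) : polyLap (P + Q) = polyLap P + polyLap Q := by
  simp [polyLap, Finset.sum_add_distrib]

lemma polyLap_sub (P Q : MvPolynomial (Fin n) ℝ) : polyLap (P - Q) = polyLap P - polyLap Q := by
  simp [polyLap, Finset.sum_sub_distrib]

lemma polyLap_smul (a : ℝ) (P : MvPolynomial (Fin n) ℝ) : polyLap (a • P) = a • polyLap P := by
  simp [polyLap, Finset.smul_sum]

lemma polyLap_mul (P Q : MvPolynomial (Fin n) ℝ) :
    polyLap (P * Q) = P * polyLap Q + 2 * ∑ i, pderiv i P * pderiv i Q + Q * polyLap P := by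
  simp only [polyLap, Finset.mul_sum, ← Finset.sum_add_distrib]
  refine Finset.sum_congr rfl fun i _ => ?_
  simp only [Derivation.leibniz, map_add, smul_eq_mul]
  ring

lemma totalDegree_polyLap_le {P : MvPolynomial (Fin n) ℝ} {d : ℕ}
    (hP : P.totalDegree ≤ d + 2) : (polyLap P).totalDegree ≤ d := by
  refine totalDegree_finsetSum_le fun i _ => ?_
  rcases totalDegree_pderiv_lt i (k := d + 2) (P := P) (by omega) with h | h
  · simp [h]
  rcases totalDegree_pderiv_lt i (k := d + 1) (P := pderiv i P) (by omega) with h | h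
  · simp [h]
  · omega

lemma eval_le_of_polyLap_nonneg (hn : 0 < n) {P : MvPolynomial (Fin n) ℝ} {c : Fin n → ℝ}
    {r M : ℝ} (hr : 0 < r) (hlap : ∀ x ∈ euclBall c r, 0 ≤ eval x (polyLap P))
    (hM : ∀ x, eval x (sqDist c) = r ^ 2 → eval x P ≤ M) {x : Fin n → ℝ}
    (hx : x ∈ euclBall c r) : eval x P ≤ M :=
  le_of_sum_pd_pd_nonneg hn isOpen_univ (contDiff_eval_mvPolynomial P).contDiffOn hr
    (Set.subset_univ _) (fun y hy => by rw [sum_pd_pd_eval]; exact hlap y hy) hM hx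

lemma eq_zero_of_polyLap_mul_eq_zero (hn : 0 < n) {c : Fin n → ℝ} {r : ℝ} (hr : 0 < r)
    {p : MvPolynomial (Fin n) ℝ} (hp : polyLap ((C (r ^ 2) - sqDist c) * p) = 0) : p = 0 := by
  have hz : ∀ x ∈ euclBall c r, eval x ((C (r ^ 2) - sqDist c) * p) = 0 := fun x hx => by
    refine le_antisymm (eval_le_of_polyLap_nonneg hn hr (fun y _ => by rw [hp, map_zero])
      (fun y hy => ?_) hx) ?_
    · simp [hy]
    · have := eval_le_of_polyLap_nonneg hn hr (P := (-1 : ℝ) • ((C (r ^ 2) - sqDist c) * p))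
        (M := 0) (fun y _ => by rw [polyLap_smul, hp, smul_zero, map_zero]) (fun y hy => by simp [hy]) hx
      rw [smul_eval] at this
      linarith
  refine eq_zero_of_eventually_eval_eq_zero (y := c) ?_
  have hc : ∀ᶠ x in 𝓝 c, eval x (sqDist c) < r ^ 2 :=
    (MvPolynomial.continuous_eval (sqDist c)).continuousAt.eventually_lt_const (by
      simpa [eval_sqDist] using pow_pos hr 2)
  filter_upwards [hc] with x hx
  have := hz x (by rw [euclBall, Set.mem_ofPred_eq]; exact hx.le)
  rw [map_mul, map_sub, eval_C] at this
  exact (mul_eq_zero.1 this).resolve_left (sub_pos.2 hx).ne'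

/-- The Dirichlet problem on a ball with polynomial data has a polynomial solution. -/
lemma exists_polyLap_eq_zero_eqOn_sphere (hn : 0 < n) (c : Fin n → ℝ) {r : ℝ} (hr : 0 < r)
    (q : MvPolynomial (Fin n) ℝ) :
    ∃ h : MvPolynomial (Fin n) ℝ, polyLap h = 0 ∧
      ∀ x, eval x (sqDist c) = r ^ 2 → eval x h = eval x q := by
  set W := restrictTotalDegree (Fin n) ℝ q.totalDegree
  have hdeg : (C (r ^ 2) - sqDist c).totalDegree ≤ 2 := by
    refine (totalDegree_sub _ _).trans (max_le
      ((totalDegree_C _).trans_le (by simp)) (totalDegree_finsetSum_le fun i _ => ?_))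
    refine (totalDegree_pow _ _).trans ?_
    have : (X i - C (c i) : MvPolynomial (Fin n) ℝ).totalDegree ≤ 1 :=
      (totalDegree_sub _ _).trans (max_le (by simp) (by simp))
    omega
  let L : W →ₗ[ℝ] W :=
    { toFun := fun p => ⟨polyLap ((C (r ^ 2) - sqDist c) * p.1), by
        rw [mem_restrictTotalDegree]
        refine totalDegree_polyLap_le ((totalDegree_mul _ _).trans ?_)
        have := (mem_restrictTotalDegree _ _ _).1 p.2
        omega⟩
      map_add' := fun p p' => Subtype.ext (by
        change polyLap (_ * (p.1 + p'.1)) = _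
        rw [mul_add, polyLap_add]; rfl)
      map_smul' := fun a p => Subtype.ext (by
        change polyLap (_ * (a • p.1)) = _
        rw [mul_smul_comm, polyLap_smul]; rfl) }
  have hL : Function.Injective L := by
    rw [injective_iff_map_eq_zero]
    intro p hp
    ext1
    exact eq_zero_of_polyLap_mul_eq_zero hn hr (congrArg Subtype.val hp)
  obtain ⟨p, hp⟩ := LinearMap.injective_iff_surjective.1 hL ⟨polyLap q, by
    rw [mem_restrictTotalDegree]
    exact totalDegree_polyLap_le (by omega)⟩
  have hp' : polyLap ((C (r ^ 2) - sqDist c) * p.1) = polyLap q := congrArg Subtype.val hp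
  refine ⟨q - (C (r ^ 2) - sqDist c) * p.1, by rw [polyLap_sub, hp', sub_self], fun x hx => ?_⟩
  simp [hx]

lemma exists_eval_near_of_continuousOn {K : Set (Fin n → ℝ)} (hK : IsCompact K)
    {f : (Fin n → ℝ) → ℝ} (hf : ContinuousOn f K) {ε : ℝ} (hε : 0 < ε) :
    ∃ q : MvPolynomial (Fin n) ℝ, ∀ x ∈ K, |eval x q - f x| < ε := by
  have : CompactSpace K := isCompact_iff_compactSpace.1 hK
  let coord : Fin n → C(K, ℝ) := fun i => ⟨fun x => x.1 i, (continuous_apply i).comp continuous_subtype_val⟩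
  have hcoord : ∀ (q : MvPolynomial (Fin n) ℝ) (x : K), aeval coord q x = eval x.1 q :=
    fun q x => by
      induction q using MvPolynomial.induction_on with
      | C a => simp
      | add p q hp hq => simp [hp, hq]
      | mul_X p i hp => simp [hp, coord]
  have hsep : (aeval (R := ℝ) coord).range.SeparatesPoints := by
    intro x y hxy
    obtain ⟨i, hi⟩ := Function.ne_iff.1 (fun h => hxy (Subtype.ext h) : x.1 ≠ y.1)
    exact ⟨coord i, ⟨coord i, ⟨X i, by simp⟩, rfl⟩, hi⟩
  obtain ⟨⟨_, q, rfl⟩, hq⟩ := ContinuousMap.exists_mem_subalgebra_near_continuous_of_separatesPoints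
    _ hsep (fun x : K => f x.1) hf.domRestrict ε hε
  refine ⟨q, fun x hx => ?_⟩
  have := hq ⟨x, hx⟩
  rw [← hcoord q ⟨x, hx⟩]
  exact this

/-- A harmonic function is uniformly approximated by harmonic polynomials on balls. -/
lemma exists_polyLap_eq_zero_near (hn : 0 < n) (hU : IsOpen U) {v : (Fin n → ℝ) → ℝ}
    (hv : ContDiffOn ℝ 2 v U) (hharm : ∀ x ∈ U, ∑ i, pd i (pd i v) x = 0) {c : Fin n → ℝ}
    {r : ℝ} (hr : 0 < r) (hsub : euclBall c r ⊆ U) {ε : ℝ} (hε : 0 < ε) :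
    ∃ h : MvPolynomial (Fin n) ℝ, polyLap h = 0 ∧
      ∀ x ∈ euclBall c r, |eval x h - v x| ≤ ε := by
  obtain ⟨q, hq⟩ := exists_eval_near_of_continuousOn (isCompact_euclBall c hr.le)
    (hv.continuousOn.mono hsub) hε
  obtain ⟨h, hh, hhq⟩ := exists_polyLap_eq_zero_eqOn_sphere hn c hr q
  have hsphere : ∀ x, eval x (sqDist c) = r ^ 2 → |eval x h - v x| < ε := fun x hx => by
    rw [hhq x hx]
    exact hq x (by rw [euclBall, Set.mem_ofPred_eq]; exact hx.le)
  have hneg : Set.EqOn (fun y => ∑ i, pd i (pd i fun z => -v z) y) (fun _ => 0) U := fun x hx => by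
    have h1 : ∀ (g : (Fin n → ℝ) → ℝ) (i : Fin n), pd i (fun z => -g z) = fun z => -pd i g z :=
      fun g i => by
        funext z
        simp [pd, fderiv_fun_neg]
    simp only [h1, Finset.sum_neg_distrib, hharm x hx, neg_zero]
  refine ⟨h, hh, fun x hx => abs_le.2 ⟨?_, ?_⟩⟩
  · have := le_of_sum_pd_pd_nonneg hn hU (f := fun y => v y + eval y (-h)) (M := ε)
      (hv.add (contDiff_eval_mvPolynomial _).contDiffOn) hr hsub
      (fun y hy => by
        rw [sum_pd_pd_add_eval hU hv _ (hsub hy), hharm y (hsub hy)]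
        have : polyLap (-h) = 0 := by simpa [polyLap] using hh
        simp [this])
      (fun y hy => by
        have := (abs_lt.1 (hsphere y hy)).1
        rw [map_neg]; linarith) hx
    rw [map_neg] at this
    linarith
  · have := le_of_sum_pd_pd_nonneg hn hU (f := fun y => -v y + eval y h) (M := ε)
      (hv.neg.add (contDiff_eval_mvPolynomial _).contDiffOn) hr hsub
      (fun y hy => by
        rw [sum_pd_pd_add_eval hU hv.neg _ (hsub hy), hh, map_zero, add_zero]
        exact (hneg (hsub hy)).ge)
      (fun y hy => by
        have := (abs_lt.1 (hsphere y hy)).2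
        linarith) hx
    linarith

/-- Bernstein's interior gradient estimate for harmonic polynomials. -/
lemma sq_eval_pderiv_le (hn : 0 < n) {w : MvPolynomial (Fin n) ℝ} (hw : polyLap w = 0)
    {c : Fin n → ℝ} {r M : ℝ} (hr : 0 < r)
    (hM : ∀ x ∈ Metric.closedBall c r, |eval x w| ≤ M) (j : Fin n) :
    (eval c (pderiv j w)) ^ 2 ≤ (2 * n + 12) * M ^ 2 / r ^ 2 := by
  set η : MvPolynomial (Fin n) ℝ := C (r ^ 2) - sqDist c with hη
  set g := pderiv j w with hg
  set l : ℝ := (2 * n + 12) * r ^ 2 with hl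
  have hl0 : 0 ≤ l := by positivity
  have hglap : polyLap g = 0 := by rw [hg, polyLap_pderiv, hw, map_zero]
  have hpη : ∀ i, pderiv i η = -(2 * (X i - C (c i))) := fun i => by
    rw [hη, map_sub, pderiv_C, pderiv_sqDist, zero_sub]
  have hηlap : polyLap η = C (-(2 * n : ℝ)) := by
    rw [hη, polyLap_sub, polyLap_sqDist]
    simp [polyLap]
  have hlap : ∀ x, eval x (polyLap (η * η * (g * g) + C l * (w * w))) =
      ∑ i, (2 * (eval x η * eval x (pderiv i g) + 2 * eval x g * eval x (pderiv i η)) ^ 2) +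
      2 * l * ∑ i, (eval x (pderiv i w)) ^ 2
      - (4 * n * eval x η + 24 * eval x (sqDist c)) * (eval x g) ^ 2 := fun x => by
    have hC : ∀ P : MvPolynomial (Fin n) ℝ, polyLap (C l * P) = C l * polyLap P := fun P => by
      rw [← smul_eq_C_mul, polyLap_smul, smul_eq_C_mul]
    have hd : ∑ i, (eval x (pderiv i η)) ^ 2 = 4 * eval x (sqDist c) := by
      rw [eval_sqDist, Finset.mul_sum]
      refine Finset.sum_congr rfl fun i _ => ?_
      rw [hpη]
      simp
      ring
    have hexp : ∑ i, (2 * (eval x η * eval x (pderiv i g) +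
          2 * eval x g * eval x (pderiv i η)) ^ 2) =
        2 * (eval x η) ^ 2 * ∑ i, (eval x (pderiv i g)) ^ 2 +
        8 * eval x η * eval x g * ∑ i, eval x (pderiv i η) * eval x (pderiv i g) +
        8 * (eval x g) ^ 2 * ∑ i, (eval x (pderiv i η)) ^ 2 := by
      simp only [Finset.mul_sum, ← Finset.sum_add_distrib]
      exact Finset.sum_congr rfl fun i _ => by ring
    have hcross : ∑ i, eval x (pderiv i (η * η)) * eval x (pderiv i (g * g)) =
        4 * eval x η * eval x g * ∑ i, eval x (pderiv i η) * eval x (pderiv i g) := by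
      simp only [Finset.mul_sum]
      refine Finset.sum_congr rfl fun i _ => ?_
      simp only [Derivation.leibniz, map_add, smul_eq_mul, map_mul]
      ring
    have hsq : ∀ P : MvPolynomial (Fin n) ℝ, eval x (polyLap (P * P)) =
        2 * eval x P * eval x (polyLap P) + 2 * ∑ i, (eval x (pderiv i P)) ^ 2 := fun P => by
      rw [polyLap_mul]
      simp only [map_add, map_mul, map_sum, map_ofNat, sq]
      ring
    rw [polyLap_add, hC, map_add, map_mul, eval_C, hsq w, hw, polyLap_mul, map_add, map_add,
      map_mul, map_mul, map_mul, map_mul, map_mul, map_sum, hsq, hsq, hglap, hηlap, hexp, hd,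
      map_ofNat]
    simp only [map_mul] at hcross ⊢
    rw [hcross, eval_C, map_zero]
    ring
  have hηnn : ∀ x ∈ euclBall c r, 0 ≤ eval x η ∧ eval x η ≤ r ^ 2 := fun x hx => by
    rw [euclBall, Set.mem_ofPred_eq] at hx
    have := eval_sqDist_nonneg c x
    rw [hη, map_sub, eval_C]
    constructor <;> linarith
  have hsubsph : ∀ x, eval x (sqDist c) = r ^ 2 → |eval x w| ≤ M := fun x hx =>
    hM x (euclBall_subset_closedBall c hr.le (by rw [euclBall, Set.mem_ofPred_eq]; exact hx.le))
  have hcmem : c ∈ euclBall c r := by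
    rw [euclBall, Set.mem_ofPred_eq, eval_sqDist]
    simpa using sq_nonneg r
  have hmax := eval_le_of_polyLap_nonneg hn (P := η * η * (g * g) + C l * (w * w))
    (M := l * M ^ 2) hr (fun x hx => by
      rw [hlap]
      have h1 : (eval x g) ^ 2 ≤ ∑ i, (eval x (pderiv i w)) ^ 2 :=
        Finset.single_le_sum (f := fun i => (eval x (pderiv i w)) ^ 2) (fun i _ => sq_nonneg _)
          (Finset.mem_univ j)
      have h2 : 0 ≤ ∑ i, (2 * (eval x η * eval x (pderiv i g) +
          2 * eval x g * eval x (pderiv i η)) ^ 2) := by positivity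
      have h3 : (4 * n * eval x η + 24 * eval x (sqDist c)) * (eval x g) ^ 2 ≤
          2 * l * (eval x g) ^ 2 := by
        refine mul_le_mul_of_nonneg_right ?_ (sq_nonneg _)
        have h4 : 4 * (n : ℝ) * eval x η ≤ 4 * n * r ^ 2 :=
          mul_le_mul_of_nonneg_left (hηnn x hx).2 (by positivity)
        have h5 : eval x (sqDist c) ≤ r ^ 2 := hx
        rw [hl]
        linarith
      have h6 := mul_le_mul_of_nonneg_left h1 (show 0 ≤ 2 * l by positivity)
      linarith)
    (fun x hx => by
      have h1 : (eval x w) ^ 2 ≤ M ^ 2 := by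
        rw [← sq_abs]
        exact pow_le_pow_left₀ (abs_nonneg _) (hsubsph x hx) 2
      have h2 := mul_le_mul_of_nonneg_left h1 hl0
      simp only [hη, map_add, map_mul, map_sub, eval_C, hx]
      linarith) hcmem
  have hηc : eval c η = r ^ 2 := by
    rw [hη, map_sub, eval_C, eval_sqDist]
    simp
  simp only [map_add, map_mul, eval_C, hηc] at hmax
  have h7 := mul_nonneg hl0 (mul_self_nonneg (eval c w))
  have h8 : r ^ 2 * r ^ 2 * (eval c g * eval c g) ≤ (2 * n + 12) * r ^ 2 * M ^ 2 := by
    rw [hl] at hmax h7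
    linarith
  rw [le_div_iff₀ (by positivity)]
  have h9 : 0 < r ^ 2 := by positivity
  refine le_of_mul_le_mul_left ?_ h9
  linarith

end HarmonicPolynomials

section HarmonicLimits

variable {n : ℕ} {P : ℕ → MvPolynomial (Fin n) ℝ} {g : (Fin n → ℝ) → ℝ} {c : Fin n → ℝ} {R : ℝ}

lemma abs_eval_pderiv_le (hn : 0 < n) {w : MvPolynomial (Fin n) ℝ} (hw : polyLap w = 0)
    {r M : ℝ} (hr : 0 < r) (hM : ∀ x ∈ Metric.closedBall c r, |eval x w| ≤ M) (j : Fin n) :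
    |eval c (pderiv j w)| ≤ (2 * n + 12) * M / r := by
  have hM0 : 0 ≤ M := (abs_nonneg _).trans (hM c (Metric.mem_closedBall_self hr.le))
  refine abs_le_of_sq_le_sq ((sq_eval_pderiv_le hn hw hr hM j).trans ?_) (by positivity)
  rw [div_pow, mul_pow]
  gcongr
  have : (0 : ℝ) ≤ n := by positivity
  nlinarith

/-- The harmonic polynomials `P m` converge to `g`, uniformly on every closed ball of radius less
than `R` about `c`. -/
def HarmonicLimit (P : ℕ → MvPolynomial (Fin n) ℝ) (g : (Fin n → ℝ) → ℝ) (c : Fin n → ℝ) (R : ℝ) :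
    Prop :=
  (∀ m, polyLap (P m) = 0) ∧
    ∀ r < R, TendstoUniformlyOn (fun m x => eval x (P m)) g atTop (Metric.closedBall c r)

namespace HarmonicLimit

lemma uniformCauchySeqOn_pderiv (hn : 0 < n) (h : HarmonicLimit P g c R) (j : Fin n) {r : ℝ}
    (hr : r < R) :
    UniformCauchySeqOn (fun m x => eval x (pderiv j (P m))) atTop (Metric.closedBall c r) := by
  obtain ⟨δ, hδ, hrδ⟩ : ∃ δ, 0 < δ ∧ r + δ < R := ⟨(R - r) / 2, by linarith, by linarith⟩
  have hC := Metric.uniformCauchySeqOn_iff.1 (h.2 _ hrδ).uniformCauchySeqOn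
  rw [Metric.uniformCauchySeqOn_iff]
  intro ε hε
  set K : ℝ := 2 * n + 12 with hK
  have hK0 : 0 < K := by positivity
  obtain ⟨N, hN⟩ := hC (ε * δ / (2 * K)) (by positivity)
  refine ⟨N, fun m hm k hk x hx => ?_⟩
  have hb := abs_eval_pderiv_le hn (c := x) (w := P m - P k) (M := ε * δ / (2 * K))
    (by rw [polyLap_sub, h.1, h.1, sub_self]) hδ (fun y hy => by
      rw [map_sub]
      refine (hN m hm k hk y ?_).le
      rw [Metric.mem_closedBall] at *
      linarith [dist_triangle y x c]) j
  rw [Real.dist_eq, ← map_sub, ← map_sub]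
  refine hb.trans_lt ?_
  rw [← hK]
  field_simp
  norm_num

lemma differentiableAt_and_pd (hn : 0 < n) (h : HarmonicLimit P g c R) :
    (∀ x ∈ Metric.ball c R, DifferentiableAt ℝ g x) ∧
      ∀ j, HarmonicLimit (fun m => pderiv j (P m)) (pd j g) c R := by
  have hlim : ∀ j, ∀ x ∈ Metric.ball c R, ∃ y,
      Tendsto (fun m => eval x (pderiv j (P m))) atTop (𝓝 y) := fun j x hx =>
    cauchySeq_tendsto_of_complete
      ((h.uniformCauchySeqOn_pderiv hn j hx).cauchySeq (Metric.mem_closedBall.2 le_rfl))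
  choose! G hG using hlim
  have hGu : ∀ j, ∀ r < R, TendstoUniformlyOn (fun m x => eval x (pderiv j (P m))) (G j) atTop
      (Metric.closedBall c r) := fun j r hr =>
    (h.uniformCauchySeqOn_pderiv hn j hr).tendstoUniformlyOn_of_tendsto fun x hx =>
      hG j x (Metric.closedBall_subset_ball hr hx)
  let L : (Fin n → ℝ) → (Fin n → ℝ) →L[ℝ] ℝ := fun x =>
    ∑ i, G i x • ContinuousLinearMap.proj (R := ℝ) (φ := fun _ : Fin n => ℝ) i
  have hL : ∀ x j, L x (Pi.single j 1) = G j x := fun x j => by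
    simp [L, Pi.single_apply]
  have hderiv : ∀ x ∈ Metric.ball c R, HasFDerivAt g (L x) x := fun x hx => by
    obtain ⟨r, hxr, hrR⟩ := exists_between (Metric.mem_ball.1 hx)
    refine hasFDerivAt_of_tendstoUniformlyOn (l := atTop) (s := Metric.ball c r)
      (f := fun m y => eval y (P m)) (f' := fun m => fderiv ℝ fun y => eval y (P m))
      Metric.isOpen_ball ?_ (fun m y _ => ((contDiff_eval_mvPolynomial (P m) (m := 1)).differentiable
        (by simp) y).hasFDerivAt) (fun y hy => (h.2 r hrR).tendsto_at
          (Metric.ball_subset_closedBall hy)) hxr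
    rw [Metric.tendstoUniformlyOn_iff]
    intro ε hε
    have hev : ∀ᶠ m in atTop, ∀ i, ∀ y ∈ Metric.closedBall c r,
        dist (G i y) (eval y (pderiv i (P m))) < ε / (n + 1) :=
      eventually_all.2 fun i => Metric.tendstoUniformlyOn_iff.1 (hGu i r hrR) _ (by positivity)
    filter_upwards [hev] with m hm y hy
    rw [dist_eq_norm]
    refine (norm_le_sum_abs_apply_single _).trans_lt ?_
    have : ∀ i ∈ Finset.univ, |(L y - fderiv ℝ (fun y => eval y (P m)) y) (Pi.single i 1)| ≤
        ε / (n + 1) := fun i _ => by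
      have h1 := congrFun (pd_eval (P m) i) y
      rw [pd] at h1
      rw [sub_apply, hL, h1, ← Real.dist_eq]
      exact (hm i y (Metric.ball_subset_closedBall hy)).le
    refine (Finset.sum_le_card_nsmul _ _ _ this).trans_lt ?_
    rw [Finset.card_univ, Fintype.card_fin, nsmul_eq_mul, ← mul_div_assoc, div_lt_iff₀ (by positivity)]
    linarith
  refine ⟨fun x hx => (hderiv x hx).differentiableAt, fun j => ⟨fun m => ?_, fun r hr => ?_⟩⟩
  · rw [polyLap_pderiv, h.1, map_zero]
  · refine (hGu j r hr).congr_right fun x hx => ?_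
    rw [pd, (hderiv x (Metric.closedBall_subset_ball hr hx)).fderiv, hL]

lemma contDiffOn_nat (hn : 0 < n) (k : ℕ) (h : HarmonicLimit P g c R) :
    ContDiffOn ℝ k g (Metric.ball c R) := by
  induction k generalizing P g with
  | zero =>
    rw [Nat.cast_zero, contDiffOn_zero]
    exact fun x hx =>
      ((h.differentiableAt_and_pd hn).1 x hx).continuousAt.continuousWithinAt
  | succ k ih =>
    rw [Nat.cast_add, Nat.cast_one, contDiffOn_succ_iff_fderiv_of_isOpen Metric.isOpen_ball]
    obtain ⟨hd, hp⟩ := h.differentiableAt_and_pd hn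
    refine ⟨fun x hx => (hd x hx).differentiableWithinAt, by simp, ?_⟩
    have : fderiv ℝ g = fun x => ∑ i, pd i g x •
        ContinuousLinearMap.proj (R := ℝ) (φ := fun _ : Fin n => ℝ) i := by
      funext x
      refine ContinuousLinearMap.ext fun y => ?_
      conv_lhs => rw [← Finset.univ_sum_single y]
      simp only [map_sum, sum_apply, smul_apply,
        ContinuousLinearMap.proj_apply, smul_eq_mul, pd]
      refine Finset.sum_congr rfl fun i _ => ?_
      rw [show (Pi.single i (y i) : Fin n → ℝ) = y i • Pi.single i 1 by
        rw [← Pi.single_smul, smul_eq_mul, mul_one], map_smul, smul_eq_mul, mul_comm]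
    rw [this]
    exact ContDiffOn.sum fun i _ => (ih (hp i)).smul contDiffOn_const

lemma contDiffOn (hn : 0 < n) (h : HarmonicLimit P g c R) :
    ContDiffOn ℝ ∞ g (Metric.ball c R) :=
  contDiffOn_infty.2 fun k => h.contDiffOn_nat hn k

lemma abs_pd_le (hn : 0 < n) (h : HarmonicLimit P g c R) {M R' δ : ℝ} (hR : R' ≤ R) (hδ : 0 < δ)
    (hM : ∀ x ∈ Metric.ball c R', |g x| ≤ M) (j : Fin n) {x : Fin n → ℝ}
    (hx : x ∈ Metric.ball c (R' - δ)) : |pd j g x| ≤ (2 * n + 12) * M / δ := by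
  rw [Metric.mem_ball] at hx
  have hK0 : (0 : ℝ) < 2 * n + 12 := by positivity
  refine le_of_forall_pos_le_add fun ε hε => ?_
  have hev := Metric.tendstoUniformlyOn_iff.1 (h.2 (dist x c + δ) (by linarith))
    (ε * δ / (2 * n + 12)) (by positivity)
  refine le_of_tendsto (((h.differentiableAt_and_pd hn).2 j).2 (dist x c) (by linarith)
    |>.tendsto_at (Metric.mem_closedBall.2 le_rfl)).abs ?_
  filter_upwards [hev] with m hm
  have hb := abs_eval_pderiv_le hn (c := x) (h.1 m) (M := M + ε * δ / (2 * n + 12)) hδ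
    (fun y hy => by
      rw [Metric.mem_closedBall] at hy
      have hyc := dist_triangle y x c
      have h1 := hm y (Metric.mem_closedBall.2 (by linarith))
      have h2 := hM y (Metric.mem_ball.2 (by linarith))
      rw [dist_comm, Real.dist_eq] at h1
      have h3 := abs_sub_abs_le_abs_sub (eval y (P m)) (g y)
      linarith) j
  refine hb.trans (le_of_eq ?_)
  field_simp

lemma abs_le_of_taylorSeriesAt_eq_zero (hn : 0 < n) (k : ℕ) (h : HarmonicLimit P g c R)
    (hT : taylorSeriesAt g c = 0) {M R' δ : ℝ} (hR : R' ≤ R) (hδ : 0 < δ)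
    (hM : ∀ x ∈ Metric.ball c R', |g x| ≤ M) {x : Fin n → ℝ}
    (hx : x ∈ Metric.ball c (R' - k * δ)) :
    |g x| ≤ M * (n * (2 * n + 12) / δ) ^ k * ‖x - c‖ ^ k / k.factorial := by
  induction k generalizing P g M R' x with
  | zero => simpa using hM x (by simpa using hx)
  | succ k ih =>
    have hx' : ‖x - c‖ < R' - (k + 1) * δ := by
      rw [← dist_eq_norm]
      simpa using hx
    have hkδ : 0 ≤ (k + 1) * δ := by positivity
    have hcR : c ∈ Metric.ball c R := Metric.mem_ball_self (by linarith [norm_nonneg (x - c)])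
    have hcR' : c ∈ Metric.ball c R' := Metric.mem_ball_self (by linarith [norm_nonneg (x - c)])
    have hM0 : 0 ≤ M := (abs_nonneg _).trans (hM c hcR')
    have hsm := h.contDiffOn hn
    obtain ⟨hd, hp⟩ := h.differentiableAt_and_pd hn
    have hpT : ∀ i, taylorSeriesAt (pd i g) c = 0 := fun i => by
      ext d
      rw [coeff_taylorSeriesAt_pd Metric.isOpen_ball hsm hcR, hT]
      simp
    have hgc : g c = 0 := by rw [← coeff_zero_taylorSeriesAt g c, hT, map_zero]
    set A : ℝ := M * (n * (2 * n + 12) / δ) ^ (k + 1) / k.factorial with hA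
    have hfd : ∀ y ∈ Metric.ball c (R' - (k + 1) * δ), ‖fderiv ℝ g y‖ ≤ A * ‖y - c‖ ^ k :=
      fun y hy => by
        refine (norm_le_sum_abs_apply_single _).trans ?_
        have hi : ∀ i ∈ Finset.univ, |fderiv ℝ g y (Pi.single i 1)| ≤
            (2 * n + 12) * M / δ * (n * (2 * n + 12) / δ) ^ k * ‖y - c‖ ^ k / k.factorial :=
          fun i _ => ih (hp i) (hpT i) (R' := R' - δ) (by linarith)
            (fun z hz => h.abs_pd_le hn hR hδ hM i hz) (by
              convert hy using 2
              ring)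
        refine (Finset.sum_le_card_nsmul _ _ _ hi).trans (le_of_eq ?_)
        rw [Finset.card_univ, Fintype.card_fin, nsmul_eq_mul, hA]
        ring
    have hline : ∀ t ∈ Set.Icc (0 : ℝ) 1, ‖c + t • (x - c) - c‖ = t * ‖x - c‖ := fun t ht => by
      rw [add_sub_cancel_left, norm_smul, Real.norm_of_nonneg ht.1]
    have hmem : ∀ t ∈ Set.Icc (0 : ℝ) 1, c + t • (x - c) ∈ Metric.ball c (R' - (k + 1) * δ) :=
      fun t ht => by
        rw [Metric.mem_ball, dist_eq_norm, hline t ht]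
        nlinarith [norm_nonneg (x - c), ht.2]
    have hder : ∀ t ∈ Set.Icc (0 : ℝ) 1, HasDerivAt (fun t : ℝ => g (c + t • (x - c)))
        (fderiv ℝ g (c + t • (x - c)) (x - c)) t := fun t ht => by
      have h1 := (hd _ (Metric.ball_subset_ball (by linarith) (hmem t ht))).hasFDerivAt
      have h2 : HasDerivAt (fun t : ℝ => c + t • (x - c)) (x - c) t := by
        simpa using ((hasDerivAt_id t).smul_const (x - c)).const_add c
      exact h1.comp_hasDerivAt t h2
    have hmain := image_norm_le_of_norm_deriv_right_le_deriv_boundary (a := 0) (b := 1)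
      (f := fun t : ℝ => g (c + t • (x - c)))
      (f' := fun t => fderiv ℝ g (c + t • (x - c)) (x - c))
      (B := fun t => A * ‖x - c‖ ^ (k + 1) / (k + 1) * t ^ (k + 1))
      (B' := fun t => A * ‖x - c‖ ^ (k + 1) * t ^ k)
      (fun t ht => (hder t ht).continuousAt.continuousWithinAt)
      (fun t ht => (hder t ⟨ht.1, ht.2.le⟩).hasDerivWithinAt)
      (by simp [hgc])
      (fun t => by
        refine ((hasDerivAt_pow (k + 1) t).const_mul
          (A * ‖x - c‖ ^ (k + 1) / (k + 1))).congr_deriv ?_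
        rw [Nat.add_sub_cancel, Nat.cast_add, Nat.cast_one]
        field_simp)
      (fun t ht => by
        have ht' : t ∈ Set.Icc (0 : ℝ) 1 := ⟨ht.1, ht.2.le⟩
        refine (ContinuousLinearMap.le_opNorm _ _).trans ?_
        refine (mul_le_mul_of_nonneg_right (hfd _ (hmem t ht')) (norm_nonneg _)).trans ?_
        rw [hline t ht', mul_pow]
        refine le_of_eq ?_
        ring)
      (Set.right_mem_Icc.2 zero_le_one)
    simp only [one_smul, add_sub_cancel, one_pow, mul_one, Real.norm_eq_abs] at hmain
    refine hmain.trans (le_of_eq ?_)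
    rw [hA, Nat.factorial_succ, Nat.cast_mul, Nat.cast_add, Nat.cast_one]
    field_simp

/-- Unique continuation: a limit of harmonic polynomials with vanishing Taylor series vanishes near
the centre. -/
lemma eventually_eq_zero (hn : 0 < n) (h : HarmonicLimit P g c R) (hR : 0 < R)
    (hT : taylorSeriesAt g c = 0) : ∀ᶠ x in 𝓝 c, g x = 0 := by
  set S := R / 2 with hS
  have hS0 : 0 < S := by positivity
  obtain ⟨M, hM⟩ := (isCompact_closedBall c S).exists_bound_of_continuousOn
    ((h.contDiffOn hn).continuousOn.mono (Metric.closedBall_subset_ball (by linarith)))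
  set K : ℝ := n * (2 * n + 12) with hK
  have hn' : (0 : ℝ) < n := by exact_mod_cast hn
  have hK0 : 0 < K := by positivity
  set ρ : ℝ := min (S / 2) (S / (4 * K * Real.exp 1)) with hρ
  have hρ0 : 0 < ρ := by positivity
  filter_upwards [Metric.ball_mem_nhds c hρ0] with x hx
  rw [Metric.mem_ball, dist_eq_norm, hρ, lt_min_iff] at hx
  set q : ℝ := 2 * K / S * Real.exp 1 * ‖x - c‖ with hq
  have hq0 : 0 ≤ q := by positivity
  have hq1 : q < 1 := by
    have := hx.2
    rw [lt_div_iff₀ (by positivity)] at this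
    rw [hq, div_mul_eq_mul_div, div_mul_eq_mul_div, div_lt_one hS0]
    linarith
  have hbound : ∀ k : ℕ, |g x| ≤ M * q ^ (k + 1) := fun k => by
    have hb := h.abs_le_of_taylorSeriesAt_eq_zero hn (k + 1) hT (R' := S)
      (δ := S / (2 * (k + 1))) (M := M) (x := x) (by linarith) (by positivity)
      (fun y hy => hM y (Metric.ball_subset_closedBall hy)) (by
        rw [Metric.mem_ball, dist_eq_norm]
        refine hx.1.trans_le (le_of_eq ?_)
        push_cast
        field_simp
        ring)
    have hM0 : 0 ≤ M := (norm_nonneg _).trans (hM c (Metric.mem_closedBall_self hS0.le))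
    refine hb.trans ?_
    have he := Real.pow_div_factorial_le_exp (x := ((k + 1 : ℕ) : ℝ)) (by positivity) (k + 1)
    have h1 : M * (n * (2 * n + 12) / (S / (2 * (k + 1)))) ^ (k + 1) * ‖x - c‖ ^ (k + 1) /
        (k + 1).factorial = M * (2 * K / S * ‖x - c‖) ^ (k + 1) *
          (((k + 1 : ℕ) : ℝ) ^ (k + 1) / (k + 1).factorial) := by
      rw [← hK, show K / (S / (2 * ((k : ℝ) + 1))) = 2 * K / S * ((k + 1 : ℕ) : ℝ) by
        push_cast; field_simp]
      rw [mul_pow (2 * K / S) ((k + 1 : ℕ) : ℝ), mul_pow (2 * K / S) ‖x - c‖]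
      ring
    rw [h1]
    refine (mul_le_mul_of_nonneg_left he (by positivity)).trans (le_of_eq ?_)
    rw [← Real.exp_one_pow, hq, mul_assoc M, ← mul_pow]
    congr 2
    ring
  have hlim : Tendsto (fun k : ℕ => M * q ^ (k + 1)) atTop (𝓝 0) := by
    simpa using ((tendsto_add_atTop_iff_nat 1).2
      (tendsto_pow_atTop_nhds_zero_of_lt_one hq0 hq1)).const_mul M
  exact abs_nonpos_iff.1 (ge_of_tendsto' hlim hbound)

end HarmonicLimit

lemma harmonicLimit_eval {w : MvPolynomial (Fin n) ℝ} (hw : polyLap w = 0) (c : Fin n → ℝ) (R : ℝ) :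
    HarmonicLimit (fun _ => w) (fun x => eval x w) c R :=
  ⟨fun _ => hw, fun _ _ => Metric.tendstoUniformlyOn_iff.2 fun ε hε =>
    Eventually.of_forall fun _ x _ => by rwa [dist_self]⟩

lemma exists_harmonicLimit (hn : 0 < n) {U : Set (Fin n → ℝ)} (hU : IsOpen U)
    {v : (Fin n → ℝ) → ℝ} (hv : ContDiffOn ℝ 2 v U)
    (hharm : ∀ x ∈ U, ∑ i, pd i (pd i v) x = 0) (hc : c ∈ U) :
    ∃ R > 0, Metric.ball c R ⊆ U ∧ ∃ P, HarmonicLimit P v c R := by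
  obtain ⟨r, hr, hrU⟩ := Metric.nhds_basis_closedBall.mem_iff.1 (hU.mem_nhds hc)
  choose P hP hPv using fun m : ℕ => exists_polyLap_eq_zero_near hn hU hv hharm hr
    ((euclBall_subset_closedBall c hr.le).trans hrU) (ε := 1 / ((m : ℝ) + 1)) (by positivity)
  have hn' : (0 : ℝ) < n := by exact_mod_cast hn
  have hRr : r / (n + 1) ≤ r := div_le_self hr.le (by linarith)
  refine ⟨r / (n + 1), by positivity,
    (Metric.ball_subset_closedBall.trans (Metric.closedBall_subset_closedBall hRr)).trans hrU,
    P, hP, fun s hs => ?_⟩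
  rw [Metric.tendstoUniformlyOn_iff]
  intro ε hε
  filter_upwards [(tendsto_order.1 tendsto_one_div_add_atTop_nhds_zero_nat).2 ε hε] with m hm x hx
  rw [dist_comm, Real.dist_eq]
  refine (hPv m x ?_).trans_lt hm
  rw [euclBall, Set.mem_ofPred_eq, eval_sqDist]
  rw [Metric.mem_closedBall, dist_eq_norm] at hx
  have hi : ∀ i ∈ Finset.univ, (x i - c i) ^ 2 ≤ (r / (n + 1)) ^ 2 := fun i _ => by
    rw [← sq_abs]
    exact pow_le_pow_left₀ (abs_nonneg _) ((norm_le_pi_norm (x - c) i).trans (hx.trans hs.le)) 2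
  refine (Finset.sum_le_card_nsmul _ _ _ hi).trans ?_
  rw [Finset.card_univ, Fintype.card_fin, nsmul_eq_mul, div_pow, ← mul_div_assoc,
    div_le_iff₀ (by positivity)]
  nlinarith [sq_nonneg r, mul_nonneg (sq_nonneg r) hn'.le, mul_nonneg (sq_nonneg r) (sq_nonneg (n : ℝ))]

/-- A harmonic polynomial with vanishing Taylor series is zero. -/
lemma eq_zero_of_taylorSeriesAt_eval_eq_zero (hn : 0 < n) {w : MvPolynomial (Fin n) ℝ}
    (hw : polyLap w = 0) (hT : taylorSeriesAt (fun x => eval x w) c = 0) : w = 0 :=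
  eq_zero_of_eventually_eval_eq_zero
    ((harmonicLimit_eval hw c 1).eventually_eq_zero hn one_pos hT)

lemma taylorSeriesAt_eq_zero_of_eventually {f : (Fin n → ℝ) → ℝ} (h : ∀ᶠ x in 𝓝 c, f x = 0) :
    taylorSeriesAt f c = 0 := by
  obtain ⟨V, hV, hVo, hcV⟩ := eventually_nhds_iff.1 h
  rw [taylorSeriesAt_congr hVo (g := fun _ => 0) hV hcV, taylorSeriesAt_zero]

lemma IsHarmonicOn.sum_pd_pd {U : Set (Fin n → ℝ)} (hU : IsOpen U) {v : (Fin n → ℝ) → ℝ}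
    (hv : IsHarmonicOn v U) : ∀ x ∈ U, ∑ i, pd i (pd i v) x = 0 := fun x hx => by
  rw [← hv.2 x hx]
  refine Finset.sum_congr rfl fun i _ => ?_
  rw [pd_pd_apply (hv.1.contDiffAt (hU.mem_nhds hx)), iteratedFDeriv_two_apply]

end HarmonicLimits

end HarmonicDivision

/-- If `u` is real analytic and `v` is harmonic on a neighborhood `U` of `a`, `v` not
identically zero, and `Z(v) ⊆ Z(u)`, then the Taylor series of `v` at `a` divides the
Taylor series of `u` at `a` in the ring of formal power series. -/
theorem stmt6 {n : ℕ} (a : Fin n → ℝ) (U : Set (Fin n → ℝ)) (hU : U ∈ 𝓝 a)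
    (hUopen : IsOpen U) (u v : (Fin n → ℝ) → ℝ)
    (hu : AnalyticOn ℝ u U) (hv : IsHarmonicOn v U)
    (hv0 : ¬ ∀ x ∈ U, v x = 0)
    (hZ : ∀ x ∈ U, v x = 0 → u x = 0) :
    ∃ f : MvPowerSeries (Fin n) ℝ, taylorSeriesAt u a = taylorSeriesAt v a * f := by
  have ha : a ∈ U := mem_of_mem_nhds hU
  rcases Nat.eq_zero_or_pos n with rfl | hn
  · have hva : v a ≠ 0 := fun h => hv0 fun x _ => by rwa [Subsingleton.elim x a]
    have hunit : IsUnit (taylorSeriesAt v a) := by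
      rw [MvPowerSeries.isUnit_iff_constantCoeff, ← MvPowerSeries.coeff_zero_eq_constantCoeff_apply,
        coeff_zero_taylorSeriesAt]
      exact hva.isUnit
    exact hunit.dvd
  have hharm := hv.sum_pd_pd hUopen
  obtain ⟨R, hR, hRU, P, hP⟩ := exists_harmonicLimit hn hUopen hv.1 hharm ha
  by_cases hT : taylorSeriesAt v a = 0
  · refine ⟨0, ?_⟩
    rw [mul_zero]
    refine taylorSeriesAt_eq_zero_of_eventually ?_
    filter_upwards [hP.eventually_eq_zero hn hR hT, hU] with x hx hxU using hZ x hxU hx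
  · exact taylorSeriesAt_dvd Metric.isOpen_ball (Metric.mem_ball_self hR)
      ((hu.contDiffOn hUopen.uniqueDiffOn).mono hRU) (hP.contDiffOn hn)
      (fun x hx => hharm x (hRU hx)) hT (fun x hx => hZ x (hRU hx))
      (fun w hw x hwx => eq_zero_of_taylorSeriesAt_eval_eq_zero hn hw hwx)
end
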